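/- Let p ≥ 2, q = p/(p−1), γ(p) = q(q−1)/8, let m₁, m₂ be positive integers, and let κ ∈ (0,1). Then the regularized Bellman function B_κ = B * ψ_κ is C^∞ on ℝ^{m₁+m₂}, and there exist a function τ_κ : [0,∞)² → (0,∞), a continuous function E_κ : ℝ^{m₁}×ℝ^{m₂} → ℝ, and a constant C > 0 depending only on m₁, m₂ and p, such that for every ξ = (ζ,η) ∈ ℝ^{m₁}×ℝ^{m₂}, writing τ = τ_κ(|ζ|,|η|): (i) for every ω = (ω₁,ω₂) ∈ ℝ^{m₁}×ℝ^{m₂}, ⟨Hess(B_κ)(ξ)·ω, ω⟩ ≥ (γ(p)/2)·(τ·|ω₁|² + τ^{−1}·|ω₂|²); (ii) ⟨∇B_κ(ξ), ξ⟩ ≥ (γ(p)/2)·(τ·|ζ|² + τ^{−1}·|η|²) − κ·E_κ(ξ); and (iii) |E_κ(ξ)| ≤ C·(|ζ|^{p−1} + |η| + |η|^{q−1} + κ^{q−1}). -/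

import Mathlib

open Real MeasureTheory

/-- The Nazarov–Treil function `β_p : [0,∞)² → [0,∞)`, where `q = p/(p-1)` and
`γ(p) = q(q-1)/8`. All powers are real powers. -/
noncomputable def betaP (p s₁ s₂ : ℝ) : ℝ :=
  let q := p / (p - 1)
  let γ := q * (q - 1) / 8
  if s₁ ^ p ≤ s₂ ^ q then
    s₁ ^ p + s₂ ^ q + γ * (s₁ ^ (2 : ℝ) * s₂ ^ (2 - q))
  else
    s₁ ^ p + s₂ ^ q + γ * ((2 / p) * s₁ ^ p + (2 / q - 1) * s₂ ^ q)

/-- The Nazarov–Treil Bellman function `B_{p,(m₁,m₂)}(ζ,η) = (1/2) β_p(|ζ|,|η|)`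
on `ℝ^{m₁} × ℝ^{m₂}`. -/
noncomputable def bellmanB (p : ℝ) (m₁ m₂ : ℕ)
    (ζ : EuclideanSpace ℝ (Fin m₁)) (η : EuclideanSpace ℝ (Fin m₂)) : ℝ :=
  (1 / 2) * betaP p ‖ζ‖ ‖η‖

/-- The Euclidean norm of a point of `ℝ^{m₁} × ℝ^{m₂} ≃ ℝ^{m₁+m₂}`. -/
noncomputable def euclNorm {m₁ m₂ : ℕ}
    (x : EuclideanSpace ℝ (Fin m₁) × EuclideanSpace ℝ (Fin m₂)) : ℝ :=
  Real.sqrt (‖x.1‖ ^ 2 + ‖x.2‖ ^ 2)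

/-- The standard bump `ψ(x) = c · exp(−1/(1−|x|²))` for `|x| < 1`, `ψ(x) = 0` otherwise,
on `ℝ^{m₁+m₂}`. -/
noncomputable def bumpPsi (m₁ m₂ : ℕ) (c : ℝ)
    (x : EuclideanSpace ℝ (Fin m₁) × EuclideanSpace ℝ (Fin m₂)) : ℝ :=
  if euclNorm x < 1 then c * Real.exp (-(1 / (1 - euclNorm x ^ 2))) else 0

/-- The rescaled bump `ψ_κ(x) = κ^{−(m₁+m₂)} ψ(x/κ)`. -/
noncomputable def bumpPsiK (m₁ m₂ : ℕ) (c κ : ℝ)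
    (x : EuclideanSpace ℝ (Fin m₁) × EuclideanSpace ℝ (Fin m₂)) : ℝ :=
  (κ ^ (m₁ + m₂))⁻¹ * bumpPsi m₁ m₂ c (κ⁻¹ • x)

/-- The regularized Bellman function `B_κ = B * ψ_κ` (convolution over `ℝ^{m₁+m₂}`
with respect to Lebesgue measure). -/
noncomputable def regBellman (p : ℝ) (m₁ m₂ : ℕ) (c κ : ℝ)
    (x : EuclideanSpace ℝ (Fin m₁) × EuclideanSpace ℝ (Fin m₂)) : ℝ :=
  ∫ y, bellmanB p m₁ m₂ y.1 y.2 * bumpPsiK m₁ m₂ c κ (x - y)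

open Filter Topology Asymptotics in
/-- Peano form of the second-order Taylor formula for the symmetric second difference. -/
theorem isLittleO_secondDiff {φ φ₁ : ℝ → ℝ} {Q : ℝ} (h₁ : ∀ᶠ t in 𝓝 0, HasDerivAt φ (φ₁ t) t)
    (h₂ : HasDerivAt φ₁ Q 0) :
    (fun t => φ t + φ (-t) - 2 * φ 0 - Q * t ^ 2) =o[𝓝 0] (fun t : ℝ => t ^ 2) := by
  rw [isLittleO_iff]
  intro ε hε
  have hlin := (hasDerivAt_iff_isLittleO_nhds_zero.1 h₂)
  rw [isLittleO_iff] at hlin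
  have hlin' := hlin (half_pos hε)
  obtain ⟨δ, hδ, hball⟩ := Metric.eventually_nhds_iff_ball.1 (h₁.and hlin')
  refine Metric.eventually_nhds_iff_ball.2 ⟨δ, hδ, fun t ht => ?_⟩
  have hmem : ∀ s ∈ Set.uIcc 0 t, |s| ≤ |t| := fun s hs => by
    simpa using Set.abs_sub_left_of_mem_uIcc hs
  have hin : ∀ s ∈ Set.uIcc 0 t, s ∈ Metric.ball (0 : ℝ) δ := fun s hs => by
    have := hmem s hs
    simp only [Metric.mem_ball, Real.dist_eq, sub_zero] at ht ⊢
    linarith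
  have hin' : ∀ s ∈ Set.uIcc 0 t, -s ∈ Metric.ball (0 : ℝ) δ := fun s hs => by
    simpa using hin s hs
  have key := Convex.norm_image_sub_le_of_norm_hasDerivWithin_le
    (f := fun t => φ t + φ (-t) - 2 * φ 0 - Q * t ^ 2)
    (f' := fun s => φ₁ s - φ₁ (-s) - 2 * Q * s) (s := Set.uIcc 0 t) (x := 0) (y := t)
    (C := ε * |t|) (fun s hs => ?_) (fun s hs => ?_) (convex_uIcc 0 t)
    Set.left_mem_uIcc Set.right_mem_uIcc
  · have e : φ 0 + φ (-0) - 2 * φ 0 - Q * 0 ^ 2 = 0 := by simp; ring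
    simp only [e, sub_zero] at key
    have e' : ‖t ^ 2‖ = |t| * |t| := by rw [norm_pow, sq, Real.norm_eq_abs]
    rw [e', ← mul_assoc]
    simpa only [Real.norm_eq_abs, sub_zero] using key
  · have d₁ := (hball s (hin s hs)).1
    have d₂ := (hball (-s) (hin' s hs)).1
    have d₃ : HasDerivAt (fun s => φ (-s)) (φ₁ (-s) * (-1)) s :=
      d₂.comp s (hasDerivAt_neg s)
    have d₄ := ((d₁.add d₃).sub_const (2 * φ 0)).sub (((hasDerivAt_id s).pow 2).const_mul Q)
    refine (d₄.congr_deriv ?_).hasDerivWithinAt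
    simp; ring
  · have b₁ := (hball s (hin s hs)).2
    have b₂ := (hball (-s) (hin' s hs)).2
    simp only [zero_add, smul_eq_mul, Real.norm_eq_abs, abs_neg] at b₁ b₂
    have hs' := hmem s hs
    rw [Real.norm_eq_abs]
    calc |φ₁ s - φ₁ (-s) - 2 * Q * s|
        = |(φ₁ s - φ₁ 0 - s * Q) - (φ₁ (-s) - φ₁ 0 - -s * Q)| := by congr 1; ring
      _ ≤ ε / 2 * |s| + ε / 2 * |s| := (abs_sub _ _).trans (add_le_add b₁ b₂)
      _ ≤ ε * |t| := by nlinarith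

open Filter Topology Asymptotics in
theorem eventually_le_secondDiff {φ φ₁ : ℝ → ℝ} {Q : ℝ}
    (h₁ : ∀ᶠ t in 𝓝 0, HasDerivAt φ (φ₁ t) t) (h₂ : HasDerivAt φ₁ Q 0) {ε : ℝ} (hε : 0 < ε) :
    ∀ᶠ t in 𝓝 0, (Q - ε) * t ^ 2 ≤ φ t + φ (-t) - 2 * φ 0 := by
  filter_upwards [(isLittleO_iff.1 (isLittleO_secondDiff h₁ h₂)) hε] with t ht
  rw [Real.norm_eq_abs, Real.norm_eq_abs, abs_of_nonneg (sq_nonneg t)] at ht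
  have := (abs_le.1 ht).1
  linarith

open Filter Topology in
/-- Schwarz's criterion: a continuous function whose lower symmetric second derivative is
nonnegative everywhere lies below its chords. -/
theorem le_chord_of_secondDiff {f : ℝ → ℝ} (hf : Continuous f)
    (h : ∀ t, ∀ ε > 0, ∀ᶠ s in 𝓝 0, -ε * s ^ 2 ≤ f (t + s) + f (t - s) - 2 * f t)
    {z : ℝ} (hz : z ∈ Set.Icc (0 : ℝ) 1) : f z ≤ (1 - z) * f 0 + z * f 1 := by
  have main : ∀ δ > 0, f z - ((1 - z) * f 0 + z * f 1) ≤ δ * (z * (1 - z)) := by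
    intro δ hδ
    set g : ℝ → ℝ := fun t => f t - ((1 - t) * f 0 + t * f 1) - δ * (t * (1 - t)) with hg
    have hgc : Continuous g := by fun_prop
    obtain ⟨t₀, ht₀, hmax⟩ := isCompact_Icc.exists_isMaxOn (Set.nonempty_Icc.2 zero_le_one)
      (hgc.continuousOn (s := Set.Icc (0 : ℝ) 1))
    suffices g t₀ ≤ 0 by
      have := (hmax hz).out.trans this
      simp only [hg] at this
      linarith
    by_contra! hpos
    have h0 : t₀ ≠ 0 := by rintro rfl; simp [hg] at hpos
    have h1 : t₀ ≠ 1 := by rintro rfl; simp [hg] at hpos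
    have hl : 0 < t₀ := lt_of_le_of_ne ht₀.1 (Ne.symm h0)
    have hr : t₀ < 1 := lt_of_le_of_ne ht₀.2 h1
    have hnear : ∀ᶠ s : ℝ in 𝓝 0, |s| < min t₀ (1 - t₀) := by
      have := Metric.ball_mem_nhds (0 : ℝ) (lt_min hl (sub_pos.2 hr))
      filter_upwards [this] with s hs
      simpa using hs
    obtain ⟨s, ⟨hs₁, hs₂⟩, hs₀⟩ :=
      (((h t₀ δ hδ).and hnear).filter_mono nhdsWithin_le_nhds |>.and
        (self_mem_nhdsWithin : ({0}ᶜ : Set ℝ) ∈ 𝓝[≠] 0)).exists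
    have hs₃ := lt_min_iff.1 hs₂
    have a := abs_lt.1 hs₃.1
    have b := abs_lt.1 hs₃.2
    have m₁ : g (t₀ + s) ≤ g t₀ := hmax ⟨by linarith, by linarith⟩
    have m₂ : g (t₀ - s) ≤ g t₀ := hmax ⟨by linarith, by linarith⟩
    simp only [hg] at m₁ m₂
    have : 0 < s ^ 2 := by
      have : s ≠ 0 := hs₀
      positivity
    nlinarith
  have hz' : 0 ≤ z * (1 - z) := mul_nonneg hz.1 (by linarith [hz.2])
  refine le_of_forall_pos_le_add fun ε hε => ?_
  have := main ε hε
  nlinarith [mul_le_mul_of_nonneg_left (show z * (1 - z) ≤ 1 by nlinarith [hz.1, hz.2]) hε.le]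

/-- Second symmetric difference of a quadratic times a power of a positive quadratic. -/
theorem eventually_le_secondDiff_quadratic_mul_rpow (a₀ a₁ a₂ b₁ b₂ α : ℝ) {b₀ ε : ℝ}
    (hb : 0 < b₀) (hε : 0 < ε) :
    ∀ᶠ t : ℝ in nhds 0,
      (2 * a₂ * b₀ ^ α + 8 * α * a₁ * b₁ * b₀ ^ (α - 1)
        + a₀ * (4 * α * (α - 1) * b₁ ^ 2 * b₀ ^ (α - 2) + 2 * α * b₂ * b₀ ^ (α - 1)) - ε) * t ^ 2 ≤
      (a₀ + 2 * a₁ * t + a₂ * t ^ 2) * (b₀ + 2 * b₁ * t + b₂ * t ^ 2) ^ α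
      + (a₀ - 2 * a₁ * t + a₂ * t ^ 2) * (b₀ - 2 * b₁ * t + b₂ * t ^ 2) ^ α
      - 2 * (a₀ * b₀ ^ α) := by
  have ha : ∀ t : ℝ, HasDerivAt (fun t => a₀ + 2 * a₁ * t + a₂ * t ^ 2)
      (2 * a₁ + 2 * a₂ * t) t := by
    intro t
    refine ((((hasDerivAt_id t).const_mul (2 * a₁)).const_add a₀).add
      (((hasDerivAt_id t).pow 2).const_mul a₂)).congr_deriv ?_
    simp; ring
  have hb' : ∀ t : ℝ, HasDerivAt (fun t => b₀ + 2 * b₁ * t + b₂ * t ^ 2)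
      (2 * b₁ + 2 * b₂ * t) t := by
    intro t
    refine ((((hasDerivAt_id t).const_mul (2 * b₁)).const_add b₀).add
      (((hasDerivAt_id t).pow 2).const_mul b₂)).congr_deriv ?_
    simp; ring
  have hlin : ∀ x y t : ℝ, HasDerivAt (fun t => 2 * x + 2 * y * t) (2 * y) t := by
    intro x y t
    refine (((hasDerivAt_id t).const_mul (2 * y)).const_add (2 * x)).congr_deriv ?_
    simp
  have hpos : ∀ᶠ t : ℝ in nhds 0, 0 < b₀ + 2 * b₁ * t + b₂ * t ^ 2 := by
    have : Continuous fun t : ℝ => b₀ + 2 * b₁ * t + b₂ * t ^ 2 := by fun_prop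
    have h0 := this.tendsto 0
    simp only [mul_zero, add_zero, ne_eq, OfNat.ofNat_ne_zero, not_false_eq_true, zero_pow] at h0
    exact h0.eventually (lt_mem_nhds hb)
  have hF : ∀ᶠ t : ℝ in nhds 0, HasDerivAt
      (fun t => (a₀ + 2 * a₁ * t + a₂ * t ^ 2) * (b₀ + 2 * b₁ * t + b₂ * t ^ 2) ^ α)
      ((2 * a₁ + 2 * a₂ * t) * (b₀ + 2 * b₁ * t + b₂ * t ^ 2) ^ α
        + (a₀ + 2 * a₁ * t + a₂ * t ^ 2) *
          ((2 * b₁ + 2 * b₂ * t) * α * (b₀ + 2 * b₁ * t + b₂ * t ^ 2) ^ (α - 1))) t := by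
    filter_upwards [hpos] with t ht
    exact (ha t).mul ((hb' t).rpow_const (Or.inl ht.ne'))
  have h0 : b₀ + 2 * b₁ * 0 + b₂ * 0 ^ 2 ≠ 0 := by simpa using hb.ne'
  have hF' := ((hlin a₁ a₂ 0).mul ((hb' 0).rpow_const (p := α) (Or.inl h0))).add
    ((ha 0).mul (((hlin b₁ b₂ 0).mul_const α).mul
      ((hb' 0).rpow_const (p := α - 1) (Or.inl h0))))
  filter_upwards [eventually_le_secondDiff hF hF' hε] with t ht
  have e : α - 1 - 1 = α - 2 := by ring
  simp only [mul_zero, add_zero, ne_eq, OfNat.ofNat_ne_zero, not_false_eq_true, zero_pow,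
    e, Pi.mul_apply] at ht
  have e₁ : ∀ x y : ℝ, x + 2 * y * -t = x - 2 * y * t := fun x y => by ring
  simp only [e₁, neg_sq] at ht
  refine le_trans (le_of_eq ?_) ht
  ring

/-- The weight `τ` for which the Hessian of the Bellman function dominates
`(γ/2) (τ |ω₁|² + τ⁻¹ |ω₂|²)`. -/
noncomputable def bellmanWeight (p q s₁ s₂ : ℝ) : ℝ :=
  max (s₁ ^ (p - 2)) (s₂ ^ (2 - q))

section ConjugateExponents

variable {p q γ : ℝ}

theorem conjExponent_mul (hp : 2 ≤ p) (hq : q = p / (p - 1)) : p * q = p + q := by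
  have : p - 1 ≠ 0 := by linarith
  rw [hq]; field_simp; ring

theorem one_lt_conjExponent (hp : 2 ≤ p) (hq : q = p / (p - 1)) : 1 < q := by
  rw [hq, lt_div_iff₀ (by linarith)]; linarith

theorem conjExponent_le_two (hp : 2 ≤ p) (hq : q = p / (p - 1)) : q ≤ 2 := by
  rw [hq, div_le_iff₀ (by linarith)]; linarith

theorem bellmanGamma_pos (hp : 2 ≤ p) (hq : q = p / (p - 1)) (hγ : γ = q * (q - 1) / 8) :
    0 < γ := by
  have := one_lt_conjExponent hp hq
  rw [hγ]
  have : 0 < q - 1 := by linarith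
  positivity

theorem bellmanGamma_le (hp : 2 ≤ p) (hq : q = p / (p - 1)) (hγ : γ = q * (q - 1) / 8) :
    γ ≤ 1 / 4 := by
  have := one_lt_conjExponent hp hq
  have := conjExponent_le_two hp hq
  rw [hγ]; nlinarith

theorem betaP_def (hq : q = p / (p - 1)) (hγ : γ = q * (q - 1) / 8) (s₁ s₂ : ℝ) :
    betaP p s₁ s₂ = if s₁ ^ p ≤ s₂ ^ q then s₁ ^ p + s₂ ^ q + γ * (s₁ ^ (2 : ℝ) * s₂ ^ (2 - q))
      else s₁ ^ p + s₂ ^ q + γ * ((2 / p) * s₁ ^ p + (2 / q - 1) * s₂ ^ q) := by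
  subst hγ hq; rfl

theorem sq_mul_rpow_eq (hp : 2 ≤ p) (hq : q = p / (p - 1)) {s₁ s₂ : ℝ} (h₁ : 0 ≤ s₁)
    (h₂ : 0 ≤ s₂) :
    s₁ ^ (2 : ℝ) * s₂ ^ (2 - q) = (s₁ ^ p) ^ (2 / p) * (s₂ ^ q) ^ (2 / q - 1) := by
  have := one_lt_conjExponent hp hq
  rw [← Real.rpow_mul h₁, ← Real.rpow_mul h₂]
  congr 2 <;> field_simp

theorem two_div_add_two_div (hp : 2 ≤ p) (hq : q = p / (p - 1)) : 2 / p + (2 / q - 1) = 1 := by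
  have := one_lt_conjExponent hp hq
  have := conjExponent_mul hp hq
  field_simp
  linarith

theorem two_div_conjExponent_sub_one_nonneg (hp : 2 ≤ p) (hq : q = p / (p - 1)) :
    0 ≤ 2 / q - 1 := by
  have := one_lt_conjExponent hp hq
  rw [sub_nonneg, le_div_iff₀ (by linarith)]
  linarith [conjExponent_le_two hp hq]

theorem sq_mul_rpow_le (hp : 2 ≤ p) (hq : q = p / (p - 1)) {s₁ s₂ : ℝ} (h₁ : 0 ≤ s₁)
    (h₂ : 0 ≤ s₂) :
    s₁ ^ (2 : ℝ) * s₂ ^ (2 - q) ≤ (2 / p) * s₁ ^ p + (2 / q - 1) * s₂ ^ q := by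
  rw [sq_mul_rpow_eq hp hq h₁ h₂]
  exact Real.geom_mean_le_arith_mean2_weighted (by positivity)
    (two_div_conjExponent_sub_one_nonneg hp hq) (by positivity) (by positivity)
    (two_div_add_two_div hp hq)

theorem sq_mul_rpow_of_eq (hp : 2 ≤ p) (hq : q = p / (p - 1)) {s₁ s₂ : ℝ} (h₁ : 0 ≤ s₁)
    (h₂ : 0 ≤ s₂) (h : s₁ ^ p = s₂ ^ q) :
    s₁ ^ (2 : ℝ) * s₂ ^ (2 - q) = (2 / p) * s₁ ^ p + (2 / q - 1) * s₂ ^ q := by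
  have e := two_div_add_two_div hp hq
  rw [sq_mul_rpow_eq hp hq h₁ h₂, h, ← Real.rpow_add' (by positivity) (by rw [e]; simp), e,
    Real.rpow_one, ← add_mul, e, one_mul]

theorem le_betaP (hp : 2 ≤ p) (hq : q = p / (p - 1)) (hγ : γ = q * (q - 1) / 8) {s₁ s₂ : ℝ}
    (h₁ : 0 ≤ s₁) (h₂ : 0 ≤ s₂) :
    s₁ ^ p + s₂ ^ q + γ * (s₁ ^ (2 : ℝ) * s₂ ^ (2 - q)) ≤ betaP p s₁ s₂ := by
  rw [betaP_def hq hγ]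
  split_ifs
  · exact le_rfl
  · have := mul_le_mul_of_nonneg_left (sq_mul_rpow_le hp hq h₁ h₂) (bellmanGamma_pos hp hq hγ).le
    linarith

theorem add_rpow_le_betaP (hp : 2 ≤ p) (hq : q = p / (p - 1)) {s₁ s₂ : ℝ}
    (h₁ : 0 ≤ s₁) (h₂ : 0 ≤ s₂) : s₁ ^ p + s₂ ^ q ≤ betaP p s₁ s₂ := by
  have := le_betaP hp hq rfl h₁ h₂
  have : 0 ≤ q * (q - 1) / 8 * (s₁ ^ (2 : ℝ) * s₂ ^ (2 - q)) :=
    mul_nonneg (bellmanGamma_pos hp hq rfl).le (by positivity)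
  linarith

theorem betaP_le (hp : 2 ≤ p) (hq : q = p / (p - 1)) (hγ : γ = q * (q - 1) / 8) {s₁ s₂ : ℝ}
    (h₁ : 0 ≤ s₁) (h₂ : 0 ≤ s₂) :
    betaP p s₁ s₂ ≤ s₁ ^ p + s₂ ^ q + γ * ((2 / p) * s₁ ^ p + (2 / q - 1) * s₂ ^ q) := by
  rw [betaP_def hq hγ]
  split_ifs
  · have := mul_le_mul_of_nonneg_left (sq_mul_rpow_le hp hq h₁ h₂) (bellmanGamma_pos hp hq hγ).le
    linarith
  · exact le_rfl

theorem betaP_le_two_mul (hp : 2 ≤ p) (hq : q = p / (p - 1)) {s₁ s₂ : ℝ}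
    (h₁ : 0 ≤ s₁) (h₂ : 0 ≤ s₂) : betaP p s₁ s₂ ≤ 2 * (s₁ ^ p + s₂ ^ q) := by
  have a := betaP_le hp hq rfl h₁ h₂
  have b := bellmanGamma_le hp hq rfl
  have b' := bellmanGamma_pos hp hq rfl
  have e := two_div_add_two_div hp hq
  have c := two_div_conjExponent_sub_one_nonneg hp hq
  have d : 0 ≤ 2 / p := by positivity
  have x : 0 ≤ s₁ ^ p := by positivity
  have y : 0 ≤ s₂ ^ q := by positivity
  have f : (2 / p) * s₁ ^ p + (2 / q - 1) * s₂ ^ q ≤ s₁ ^ p + s₂ ^ q := by nlinarith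
  have f0 : 0 ≤ (2 / p) * s₁ ^ p + (2 / q - 1) * s₂ ^ q := by positivity
  nlinarith

theorem continuous_betaP_comp (hp : 2 ≤ p) {X : Type*} [TopologicalSpace X] {f g : X → ℝ}
    (hf : Continuous f) (hg : Continuous g) (hf₀ : ∀ x, 0 ≤ f x) (hg₀ : ∀ x, 0 ≤ g x) :
    Continuous fun x => betaP p (f x) (g x) := by
  obtain ⟨q, hq⟩ : ∃ q, q = p / (p - 1) := ⟨_, rfl⟩
  have h1 := one_lt_conjExponent hp hq
  have h2 := conjExponent_le_two hp hq
  have cf : Continuous fun x => f x ^ p := hf.rpow_const fun _ => Or.inr (by linarith)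
  have cg : Continuous fun x => g x ^ q := hg.rpow_const fun _ => Or.inr (by linarith)
  have cf' : Continuous fun x => f x ^ (2 : ℝ) := hf.rpow_const fun _ => Or.inr (by norm_num)
  have cg' : Continuous fun x => g x ^ (2 - q) := hg.rpow_const fun _ => Or.inr (by linarith)
  simp only [betaP_def hq rfl]
  refine Continuous.if_le (by fun_prop) (by fun_prop) cf cg fun x hx => ?_
  rw [sq_mul_rpow_of_eq hp hq (hf₀ x) (hg₀ x) hx]

theorem rpow_le_rpow_conj_iff (hp : 2 ≤ p) (hq : q = p / (p - 1)) {s₁ s₂ : ℝ} (h₁ : 0 ≤ s₁)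
    (h₂ : 0 ≤ s₂) : s₁ ^ p ≤ s₂ ^ q ↔ s₁ ≤ s₂ ^ (q - 1) := by
  have e : s₂ ^ q = (s₂ ^ (q - 1)) ^ p := by
    rw [← Real.rpow_mul h₂]
    congr 1
    linarith [conjExponent_mul hp hq]
  rw [e, Real.rpow_le_rpow_iff h₁ (by positivity) (by linarith)]

theorem rpow_rpow_sub_two (hp : 2 ≤ p) (hq : q = p / (p - 1)) {s₂ : ℝ} (h₂ : 0 ≤ s₂) :
    (s₂ ^ (q - 1)) ^ (p - 2) = s₂ ^ (2 - q) := by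
  rw [← Real.rpow_mul h₂]
  congr 1
  linarith [conjExponent_mul hp hq]

theorem bellmanWeight_of_le (hp : 2 ≤ p) (hq : q = p / (p - 1)) {s₁ s₂ : ℝ} (h₁ : 0 ≤ s₁)
    (h₂ : 0 ≤ s₂) (h : s₁ ^ p ≤ s₂ ^ q) : bellmanWeight p q s₁ s₂ = s₂ ^ (2 - q) := by
  refine max_eq_right ?_
  rw [← rpow_rpow_sub_two hp hq h₂]
  exact Real.rpow_le_rpow h₁ ((rpow_le_rpow_conj_iff hp hq h₁ h₂).1 h) (by linarith)

theorem bellmanWeight_of_ge (hp : 2 ≤ p) (hq : q = p / (p - 1)) {s₁ s₂ : ℝ} (h₁ : 0 ≤ s₁)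
    (h₂ : 0 ≤ s₂) (h : s₂ ^ q < s₁ ^ p) : bellmanWeight p q s₁ s₂ = s₁ ^ (p - 2) := by
  refine max_eq_left ?_
  rw [← rpow_rpow_sub_two hp hq h₂]
  refine Real.rpow_le_rpow (by positivity) ?_ (by linarith)
  have := mt (rpow_le_rpow_conj_iff hp hq h₁ h₂).2 (not_le.2 h)
  exact (not_le.1 this).le

theorem bellmanWeight_nonneg {s₁ s₂ : ℝ} (h₂ : 0 ≤ s₂) : 0 ≤ bellmanWeight p q s₁ s₂ :=
  le_max_of_le_right (by positivity)

theorem bellmanWeight_pos {s₁ s₂ : ℝ} (h₂ : 0 < s₂) : 0 < bellmanWeight p q s₁ s₂ :=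
  lt_max_of_lt_right (by positivity)

theorem continuous_bellmanWeight_comp (hp : 2 ≤ p) (hq : q = p / (p - 1)) {X : Type*}
    [TopologicalSpace X] {f g : X → ℝ} (hf : Continuous f) (hg : Continuous g) :
    Continuous fun x => bellmanWeight p q (f x) (g x) := by
  have h2 := conjExponent_le_two hp hq
  exact (hf.rpow_const fun _ => Or.inr (by linarith)).max
    (hg.rpow_const fun _ => Or.inr (by linarith))

theorem bellmanWeight_mul_sq_le (hp : 2 ≤ p) (hq : q = p / (p - 1)) {s₁ s₂ : ℝ} (h₁ : 0 ≤ s₁)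
    (h₂ : 0 ≤ s₂) : bellmanWeight p q s₁ s₂ * s₁ ^ 2 ≤ s₁ ^ p + s₂ ^ q := by
  have x : 0 ≤ s₁ ^ p := by positivity
  have y : 0 ≤ s₂ ^ q := by positivity
  rw [bellmanWeight, max_mul_of_nonneg _ _ (sq_nonneg _)]
  refine max_le ?_ ?_
  · rw [← Real.rpow_natCast s₁ 2, ← Real.rpow_add' h₁ (by push_cast; linarith)]
    push_cast
    rw [sub_add_cancel]
    linarith
  · have a := sq_mul_rpow_le hp hq h₁ h₂
    have e := two_div_add_two_div hp hq
    have c := two_div_conjExponent_sub_one_nonneg hp hq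
    have d : 0 ≤ 2 / p := by positivity
    rw [Real.rpow_two] at a
    nlinarith

theorem sq_le_bellmanWeight_mul (hp : 2 ≤ p) (hq : q = p / (p - 1)) {s₁ s₂ : ℝ}
    (h₂ : 0 ≤ s₂) : s₂ ^ 2 ≤ bellmanWeight p q s₁ s₂ * s₂ ^ q := by
  have h1 := one_lt_conjExponent hp hq
  have : s₂ ^ 2 = s₂ ^ (2 - q) * s₂ ^ q := by
    rw [← Real.rpow_add' h₂ (by norm_num)]
    norm_num
  rw [this]
  exact mul_le_mul_of_nonneg_right (le_max_right _ _) (by positivity)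

theorem two_mul_sub_sq_mul_bellmanWeight_le (hp : 2 ≤ p) (hq : q = p / (p - 1)) {s₁ s₂ : ℝ}
    (h₂ : 0 ≤ s₂) (a : ℝ) :
    2 * a * s₂ - a ^ 2 * bellmanWeight p q s₁ s₂ ≤ s₂ ^ q := by
  rcases h₂.eq_or_lt with rfl | h
  · have : 0 ≤ a ^ 2 * bellmanWeight p q s₁ 0 :=
      mul_nonneg (sq_nonneg _) (bellmanWeight_nonneg le_rfl)
    have : (0 : ℝ) ≤ 0 ^ q := by positivity
    linarith
  · have t := bellmanWeight_pos (p := p) (q := q) (s₁ := s₁) h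
    have := sq_le_bellmanWeight_mul (s₁ := s₁) hp hq h₂
    refine le_of_mul_le_mul_left ?_ t
    nlinarith [sq_nonneg (s₂ - a * bellmanWeight p q s₁ s₂)]

theorem rpow_tangent_le (hp : 2 ≤ p) {s x : ℝ} (hs : 0 ≤ s) (hx : 0 ≤ x) :
    s ^ p + p / 2 * s ^ (p - 2) * (x ^ 2 - s ^ 2) ≤ x ^ p := by
  rcases hs.eq_or_lt with rfl | h
  · rcases hp.eq_or_lt with rfl | hp'
    · simp
    · rw [Real.zero_rpow (by linarith), Real.zero_rpow (by linarith)]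
      have : 0 ≤ x ^ p := by positivity
      simpa
  · have b := one_add_mul_self_le_rpow_one_add (s := x ^ 2 / s ^ 2 - 1)
      (by have : 0 ≤ x ^ 2 / s ^ 2 := by positivity
          linarith) (p := p / 2) (by linarith)
    have e : (1 + (x ^ 2 / s ^ 2 - 1)) ^ (p / 2) = x ^ p / s ^ p := by
      rw [add_sub_cancel, ← div_pow, ← Real.rpow_natCast, ← Real.rpow_mul (by positivity),
        Real.div_rpow hx hs]
      congr 2 <;> push_cast <;> ring
    have hsp : 0 < s ^ p := by positivity
    rw [e, le_div_iff₀ hsp] at b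
    refine le_trans (le_of_eq ?_) b
    rw [Real.rpow_sub h, Real.rpow_two]
    field_simp

end ConjugateExponents

theorem bellmanHessian_linear_algebra {q γ A D F G R P M : ℝ} (hγ : γ = q * (q - 1) / 8)
    (hq₁ : 1 < q) (hq₂ : q ≤ 2) (hR : 0 ≤ R) (hG : 0 ≤ G) (hM : 0 ≤ M) (t₁ : A ≤ R)
    (t₂ : -M ≤ D) (t₃ : F ≤ G) (t₄ : G ≤ R) (t₅ : 4 * M ≤ P + 4 * R) :
    γ * (P + R) ≤ (4 * (q / 2) * (q / 2 - 1) * A + 2 * (q / 2) * R)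
      + γ * (2 * P + 8 * ((2 - q) / 2) * D
        + (4 * ((2 - q) / 2) * ((2 - q) / 2 - 1) * F + 2 * ((2 - q) / 2) * G)) := by
  have hγ0 : 0 < γ := by
    have : 0 < q - 1 := by linarith
    rw [hγ]; positivity
  have k₁ : 8 * γ * R ≤ 4 * (q / 2) * (q / 2 - 1) * A + 2 * (q / 2) * R := by
    have := mul_le_mul_of_nonneg_left t₁ (show 0 ≤ q * (2 - q) by nlinarith)
    rw [hγ]
    linarith
  have k₂ : -(4 * M) ≤ 8 * ((2 - q) / 2) * D := by
    have h₁ := mul_le_mul_of_nonneg_left t₂ (show 0 ≤ 4 * (2 - q) by linarith)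
    have h₂ := mul_nonneg (show 0 ≤ q - 1 by linarith) hM
    linarith
  have k₃ : -R ≤ 4 * ((2 - q) / 2) * ((2 - q) / 2 - 1) * F + 2 * ((2 - q) / 2) * G := by
    have h₁ : (2 - q) * q * F ≤ (2 - q) * q * G :=
      mul_le_mul_of_nonneg_left t₃ (by nlinarith)
    have h₂ : (2 - q) * (q - 1) * G ≤ 1 * G := mul_le_mul_of_nonneg_right (by nlinarith) hG
    linarith
  have k₄ : γ * (P + R) ≤ 8 * γ * R + γ * (2 * P - 4 * M - R) := by
    have := mul_nonneg hγ0.le (show 0 ≤ P + 4 * R - 4 * M by linarith)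
    have := mul_nonneg hγ0.le hR
    linarith
  have k₅ : γ * (2 * P - 4 * M - R) ≤ γ * (2 * P + 8 * ((2 - q) / 2) * D
      + (4 * ((2 - q) / 2) * ((2 - q) / 2 - 1) * F + 2 * ((2 - q) / 2) * G)) :=
    mul_le_mul_of_nonneg_left (by linarith) hγ0.le
  linarith

theorem bellmanHessian_algebra {q γ σ u s X Y a c : ℝ} (hγ : γ = q * (q - 1) / 8)
    (hq₁ : 1 < q) (hq₂ : q ≤ 2)
    (hσ : 0 < σ) (hu : 0 < u) (hs : 0 ≤ s) (hsu : s ≤ σ * u) (hX : 0 ≤ X) (hY : 0 ≤ Y)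
    (ha : |a| ≤ s * X) (hc : |c| ≤ σ * Y) :
    γ * (X ^ 2 / u + u * Y ^ 2) ≤
      (4 * (q / 2) * (q / 2 - 1) * c ^ 2 * (u / σ ^ 2) + 2 * (q / 2) * Y ^ 2 * u)
      + γ * (2 * X ^ 2 * (1 / u) + 8 * ((2 - q) / 2) * a * c * (1 / (u * σ ^ 2))
        + s ^ 2 * (4 * ((2 - q) / 2) * ((2 - q) / 2 - 1) * c ^ 2 * (1 / (u * σ ^ 4))
          + 2 * ((2 - q) / 2) * Y ^ 2 * (1 / (u * σ ^ 2)))) := by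
  have hγ0 : 0 < γ := by
    have : 0 < q - 1 := by linarith
    rw [hγ]; positivity
  have hc2 : c ^ 2 ≤ σ ^ 2 * Y ^ 2 := by
    rw [← mul_pow, ← sq_abs]; gcongr
  have hac : |a * c| ≤ σ ^ 2 * u * (X * Y) := by
    rw [abs_mul]
    calc |a| * |c| ≤ (s * X) * (σ * Y) := by gcongr
      _ ≤ ((σ * u) * X) * (σ * Y) := by gcongr
      _ = _ := by ring
  have t₁ : c ^ 2 * (u / σ ^ 2) ≤ u * Y ^ 2 := by
    rw [mul_div_assoc', div_le_iff₀ (by positivity)]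
    nlinarith
  have t₂ : -(X * Y) ≤ a * c * (1 / (u * σ ^ 2)) := by
    rw [mul_one_div, le_div_iff₀ (by positivity)]
    nlinarith [(abs_le.1 hac).1]
  have t₃ : s ^ 2 * (c ^ 2 * (1 / (u * σ ^ 4))) ≤ s ^ 2 * (Y ^ 2 * (1 / (u * σ ^ 2))) := by
    gcongr s ^ 2 * ?_
    rw [mul_one_div, mul_one_div, div_le_div_iff₀ (by positivity) (by positivity)]
    nlinarith [mul_le_mul_of_nonneg_right hc2 (show 0 ≤ u * σ ^ 2 by positivity)]
  have t₄ : s ^ 2 * (Y ^ 2 * (1 / (u * σ ^ 2))) ≤ u * Y ^ 2 := by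
    rw [mul_one_div, mul_div_assoc', div_le_iff₀ (by positivity)]
    have : s ^ 2 ≤ (σ * u) ^ 2 := by gcongr
    nlinarith [mul_le_mul_of_nonneg_right this (sq_nonneg Y)]
  have t₅ : 4 * (X * Y) ≤ X ^ 2 / u + 4 * (u * Y ^ 2) := by
    have : X ^ 2 / u + 4 * (u * Y ^ 2) - 4 * (X * Y) = (X - 2 * u * Y) ^ 2 / u := by
      field_simp; ring
    have : 0 ≤ (X - 2 * u * Y) ^ 2 / u := by positivity
    linarith
  have e₁ : 2 * X ^ 2 * (1 / u) = 2 * (X ^ 2 / u) := by ring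
  have key := bellmanHessian_linear_algebra hγ hq₁ hq₂ (by positivity) (by positivity)
    (by positivity) t₁ t₂ t₃ t₄ t₅
  refine key.trans (le_of_eq ?_)
  ring

theorem norm_rpow_eq_sq_rpow {V : Type*} [NormedAddCommGroup V] (v : V) (r : ℝ) :
    ‖v‖ ^ r = (‖v‖ ^ 2) ^ (r / 2) := by
  rw [← Real.rpow_natCast, ← Real.rpow_mul (norm_nonneg v)]
  congr 1
  push_cast; ring

section NormPowers

variable {V : Type*} [NormedAddCommGroup V] [InnerProductSpace ℝ V]

theorem norm_add_smul_sq_eq (v w : V) (t : ℝ) :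
    ‖v + t • w‖ ^ 2 = ‖v‖ ^ 2 + 2 * inner ℝ v w * t + ‖w‖ ^ 2 * t ^ 2 := by
  rw [norm_add_sq_real, inner_smul_right, norm_smul, mul_pow, Real.norm_eq_abs, sq_abs]
  ring

theorem norm_sub_smul_sq_eq (v w : V) (t : ℝ) :
    ‖v - t • w‖ ^ 2 = ‖v‖ ^ 2 - 2 * inner ℝ v w * t + ‖w‖ ^ 2 * t ^ 2 := by
  rw [norm_sub_sq_real, inner_smul_right, norm_smul, mul_pow, Real.norm_eq_abs, sq_abs]
  ring

theorem le_secondDiff_norm_rpow {p : ℝ} (hp : 2 ≤ p) (v w : V) (t : ℝ) :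
    p * ‖v‖ ^ (p - 2) * ‖w‖ ^ 2 * t ^ 2 ≤ ‖v + t • w‖ ^ p + ‖v - t • w‖ ^ p - 2 * ‖v‖ ^ p := by
  have h₁ := rpow_tangent_le hp (norm_nonneg v) (norm_nonneg (v + t • w))
  have h₂ := rpow_tangent_le hp (norm_nonneg v) (norm_nonneg (v - t • w))
  rw [norm_add_smul_sq_eq] at h₁
  rw [norm_sub_smul_sq_eq] at h₂
  linarith

theorem eventually_le_secondDiff_norm_rpow {v : V} (hv : v ≠ 0) (w : V) (r : ℝ) {ε : ℝ}
    (hε : 0 < ε) :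
    ∀ᶠ t : ℝ in nhds 0,
      (4 * (r / 2) * (r / 2 - 1) * inner ℝ v w ^ 2 * (‖v‖ ^ 2) ^ (r / 2 - 2)
        + 2 * (r / 2) * ‖w‖ ^ 2 * (‖v‖ ^ 2) ^ (r / 2 - 1) - ε) * t ^ 2 ≤
      ‖v + t • w‖ ^ r + ‖v - t • w‖ ^ r - 2 * ‖v‖ ^ r := by
  have hb : 0 < ‖v‖ ^ 2 := by positivity
  filter_upwards [eventually_le_secondDiff_quadratic_mul_rpow 1 0 0 (inner ℝ v w) (‖w‖ ^ 2)
    (r / 2) hb hε] with t ht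
  rw [norm_rpow_eq_sq_rpow v, norm_rpow_eq_sq_rpow (v + t • w), norm_rpow_eq_sq_rpow (v - t • w),
    norm_add_smul_sq_eq, norm_sub_smul_sq_eq]
  linarith

theorem eventually_le_secondDiff_norm_sq_mul_rpow {U : Type*} [NormedAddCommGroup U]
    [InnerProductSpace ℝ U] (u z : U) {v : V} (hv : v ≠ 0) (w : V) (r : ℝ) {ε : ℝ}
    (hε : 0 < ε) :
    ∀ᶠ t : ℝ in nhds 0,
      (2 * ‖z‖ ^ 2 * (‖v‖ ^ 2) ^ (r / 2)
        + 8 * (r / 2) * inner ℝ u z * inner ℝ v w * (‖v‖ ^ 2) ^ (r / 2 - 1)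
        + ‖u‖ ^ 2 * (4 * (r / 2) * (r / 2 - 1) * inner ℝ v w ^ 2 * (‖v‖ ^ 2) ^ (r / 2 - 2)
        + 2 * (r / 2) * ‖w‖ ^ 2 * (‖v‖ ^ 2) ^ (r / 2 - 1)) - ε) * t ^ 2 ≤
      ‖u + t • z‖ ^ 2 * ‖v + t • w‖ ^ r + ‖u - t • z‖ ^ 2 * ‖v - t • w‖ ^ r
        - 2 * (‖u‖ ^ 2 * ‖v‖ ^ r) := by
  have hb : 0 < ‖v‖ ^ 2 := by positivity
  filter_upwards [eventually_le_secondDiff_quadratic_mul_rpow (‖u‖ ^ 2) (inner ℝ u z) (‖z‖ ^ 2)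
    (inner ℝ v w) (‖w‖ ^ 2) (r / 2) hb hε] with t ht
  rw [norm_rpow_eq_sq_rpow v, norm_rpow_eq_sq_rpow (v + t • w), norm_rpow_eq_sq_rpow (v - t • w),
    norm_add_smul_sq_eq, norm_sub_smul_sq_eq, norm_add_smul_sq_eq, norm_sub_smul_sq_eq]
  exact ht

end NormPowers

section LocalConvexity

variable {p q γ : ℝ} {m₁ m₂ : ℕ}

theorem bellmanB_nonneg (hp : 2 ≤ p) (ζ : EuclideanSpace ℝ (Fin m₁))
    (η : EuclideanSpace ℝ (Fin m₂)) : 0 ≤ bellmanB p m₁ m₂ ζ η := by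
  have := add_rpow_le_betaP hp rfl (norm_nonneg ζ) (norm_nonneg η)
  have : 0 ≤ ‖ζ‖ ^ p + ‖η‖ ^ (p / (p - 1)) := by positivity
  rw [bellmanB]; linarith

theorem continuous_bellmanB (hp : 2 ≤ p) :
    Continuous fun x : EuclideanSpace ℝ (Fin m₁) × EuclideanSpace ℝ (Fin m₂) =>
      bellmanB p m₁ m₂ x.1 x.2 :=
  (continuous_betaP_comp hp continuous_fst.norm continuous_snd.norm (fun _ => norm_nonneg _)
    fun _ => norm_nonneg _).const_mul _

/-- Where `|η|^q < |ζ|^p`, the Bellman function is locally a combination of powers of norms. -/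
theorem eventually_bellmanB_secondDiff_eq (hp : 2 ≤ p) (hq : q = p / (p - 1))
    (hγ : γ = q * (q - 1) / 8) {ζ : EuclideanSpace ℝ (Fin m₁)} {η : EuclideanSpace ℝ (Fin m₂)}
    (h : ‖η‖ ^ q < ‖ζ‖ ^ p) (ω₁ : EuclideanSpace ℝ (Fin m₁)) (ω₂ : EuclideanSpace ℝ (Fin m₂)) :
    ∀ᶠ t : ℝ in nhds 0,
      bellmanB p m₁ m₂ (ζ + t • ω₁) (η + t • ω₂) + bellmanB p m₁ m₂ (ζ - t • ω₁) (η - t • ω₂)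
        - 2 * bellmanB p m₁ m₂ ζ η =
      1 / 2 * ((1 + γ * (2 / p)) * (‖ζ + t • ω₁‖ ^ p + ‖ζ - t • ω₁‖ ^ p - 2 * ‖ζ‖ ^ p)
        + (1 + γ * (2 / q - 1)) * (‖η + t • ω₂‖ ^ q + ‖η - t • ω₂‖ ^ q - 2 * ‖η‖ ^ q)) := by
  have h1 := one_lt_conjExponent hp hq
  have c₁ : Continuous fun t : ℝ => ‖ζ + t • ω₁‖ ^ p :=
    Continuous.rpow_const (by fun_prop) fun _ => Or.inr (by linarith)
  have c₂ : Continuous fun t : ℝ => ‖η + t • ω₂‖ ^ q :=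
    Continuous.rpow_const (by fun_prop) fun _ => Or.inr (by linarith)
  have c₃ : Continuous fun t : ℝ => ‖ζ - t • ω₁‖ ^ p :=
    Continuous.rpow_const (by fun_prop) fun _ => Or.inr (by linarith)
  have c₄ : Continuous fun t : ℝ => ‖η - t • ω₂‖ ^ q :=
    Continuous.rpow_const (by fun_prop) fun _ => Or.inr (by linarith)
  filter_upwards [c₂.continuousAt.eventually_lt c₁.continuousAt (x₀ := 0) (by simpa using h),
    c₄.continuousAt.eventually_lt c₃.continuousAt (x₀ := 0) (by simpa using h)] with t ht₁ ht₂
  simp only [bellmanB, betaP_def hq hγ, if_neg (not_le.2 h), if_neg (not_le.2 ht₁),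
    if_neg (not_le.2 ht₂)]
  ring

theorem eventually_le_bellmanB_secondDiff_of_gt (hp : 2 ≤ p) (hq : q = p / (p - 1))
    (hγ : γ = q * (q - 1) / 8) {ζ : EuclideanSpace ℝ (Fin m₁)} {η : EuclideanSpace ℝ (Fin m₂)}
    (hη : η ≠ 0) (h : ‖η‖ ^ q < ‖ζ‖ ^ p) (ω₁ : EuclideanSpace ℝ (Fin m₁))
    (ω₂ : EuclideanSpace ℝ (Fin m₂)) {ε : ℝ} (hε : 0 < ε) :
    ∀ᶠ t : ℝ in nhds 0,
      (γ / 2 * (bellmanWeight p q ‖ζ‖ ‖η‖ * ‖ω₁‖ ^ 2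
        + (bellmanWeight p q ‖ζ‖ ‖η‖)⁻¹ * ‖ω₂‖ ^ 2) - ε) * t ^ 2 ≤
      bellmanB p m₁ m₂ (ζ + t • ω₁) (η + t • ω₂) + bellmanB p m₁ m₂ (ζ - t • ω₁) (η - t • ω₂)
        - 2 * bellmanB p m₁ m₂ ζ η := by
  have h1 := one_lt_conjExponent hp hq
  have h2 := conjExponent_le_two hp hq
  have hγ₀ := bellmanGamma_pos hp hq hγ
  have hγ₁ := bellmanGamma_le hp hq hγ
  have hη' : 0 < ‖η‖ := norm_pos_iff.2 hη
  have hw := bellmanWeight_of_ge hp hq (norm_nonneg ζ) (norm_nonneg η) h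
  have hwη : ‖η‖ ^ (2 - q) ≤ ‖ζ‖ ^ (p - 2) := hw ▸ le_max_right _ _
  have hinv : (‖ζ‖ ^ (p - 2))⁻¹ ≤ ‖η‖ ^ (q - 2) := by
    rw [← neg_sub 2 q, Real.rpow_neg hη'.le]
    exact inv_anti₀ (by positivity) hwη
  have hc : 0 ≤ 2 / q - 1 := two_div_conjExponent_sub_one_nonneg hp hq
  have hc₁ : 1 ≤ 1 + γ * (2 / p) := by
    have : 0 ≤ γ * (2 / p) := by positivity
    linarith
  have hc₂ : 1 ≤ 1 + γ * (2 / q - 1) := by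
    have : 0 ≤ γ * (2 / q - 1) := by positivity
    linarith
  have hε' : 0 < ε / (1 + γ * (2 / q - 1)) := by positivity
  filter_upwards [eventually_bellmanB_secondDiff_eq hp hq hγ h ω₁ ω₂,
    eventually_le_secondDiff_norm_rpow hη ω₂ q hε'] with t ht₁ ht₂
  rw [ht₁, hw]
  have e₁ : (‖η‖ ^ 2) ^ (q / 2 - 1) = ‖η‖ ^ (q - 2) := by
    rw [← Real.rpow_natCast, ← Real.rpow_mul hη'.le]
    congr 1; push_cast; ring
  have e₂ : (‖η‖ ^ 2) ^ (q / 2 - 2) * ‖η‖ ^ 2 = ‖η‖ ^ (q - 2) := by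
    rw [← e₁, ← Real.rpow_add_one (by positivity)]
    congr 1; ring
  have hin : inner ℝ η ω₂ ^ 2 ≤ ‖η‖ ^ 2 * ‖ω₂‖ ^ 2 := by
    rw [← mul_pow, ← sq_abs]
    gcongr
    exact abs_real_inner_le_norm η ω₂
  have hin' : inner ℝ η ω₂ ^ 2 * (‖η‖ ^ 2) ^ (q / 2 - 2) ≤ ‖η‖ ^ (q - 2) * ‖ω₂‖ ^ 2 := by
    rw [← e₂]
    have := mul_le_mul_of_nonneg_right hin (show 0 ≤ (‖η‖ ^ 2) ^ (q / 2 - 2) by positivity)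
    linarith
  rw [e₁] at ht₂
  have hlow : (8 * γ * (‖η‖ ^ (q - 2) * ‖ω₂‖ ^ 2) - ε / (1 + γ * (2 / q - 1))) * t ^ 2 ≤
      ‖η + t • ω₂‖ ^ q + ‖η - t • ω₂‖ ^ q - 2 * ‖η‖ ^ q := by
    refine le_trans (mul_le_mul_of_nonneg_right ?_ (sq_nonneg t)) ht₂
    have := mul_le_mul_of_nonneg_left hin' (show 0 ≤ q * (2 - q) by nlinarith)
    rw [hγ]
    linarith
  have hlow₁ := le_secondDiff_norm_rpow hp ζ ω₁ t
  have k₁ := mul_le_mul_of_nonneg_left hlow (show 0 ≤ 1 + γ * (2 / q - 1) by linarith)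
  have k₂ : p * ‖ζ‖ ^ (p - 2) * ‖ω₁‖ ^ 2 * t ^ 2 ≤
      (1 + γ * (2 / p)) * (‖ζ + t • ω₁‖ ^ p + ‖ζ - t • ω₁‖ ^ p - 2 * ‖ζ‖ ^ p) := by
    refine hlow₁.trans (le_mul_of_one_le_left (le_trans (by positivity) hlow₁) hc₁)
  have k₃ : (1 + γ * (2 / q - 1)) *
      ((8 * γ * (‖η‖ ^ (q - 2) * ‖ω₂‖ ^ 2) - ε / (1 + γ * (2 / q - 1))) * t ^ 2) =
      (1 + γ * (2 / q - 1)) * (8 * γ * (‖η‖ ^ (q - 2) * ‖ω₂‖ ^ 2) * t ^ 2) - ε * t ^ 2 := by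
    have aux : ∀ K a : ℝ, K ≠ 0 → K * ((a - ε / K) * t ^ 2) = K * (a * t ^ 2) - ε * t ^ 2 := by
      intro K a hK
      field_simp
    exact aux _ _ (by positivity)
  have k₄ : 8 * γ * (‖η‖ ^ (q - 2) * ‖ω₂‖ ^ 2) * t ^ 2 ≤
      (1 + γ * (2 / q - 1)) * (8 * γ * (‖η‖ ^ (q - 2) * ‖ω₂‖ ^ 2) * t ^ 2) :=
    le_mul_of_one_le_left (by positivity) hc₂
  have k₅ : γ * ((‖ζ‖ ^ (p - 2))⁻¹ * ‖ω₂‖ ^ 2) * t ^ 2 ≤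
      8 * γ * (‖η‖ ^ (q - 2) * ‖ω₂‖ ^ 2) * t ^ 2 := by
    gcongr
    linarith
  have k₆ : γ * (‖ζ‖ ^ (p - 2) * ‖ω₁‖ ^ 2 * t ^ 2) ≤ p * (‖ζ‖ ^ (p - 2) * ‖ω₁‖ ^ 2 * t ^ 2) := by
    gcongr
    linarith
  have k₇ : 0 ≤ ε * t ^ 2 := by positivity
  linarith

theorem eventually_le_bellmanB_secondDiff_of_le (hp : 2 ≤ p) (hq : q = p / (p - 1))
    (hγ : γ = q * (q - 1) / 8) {ζ : EuclideanSpace ℝ (Fin m₁)} {η : EuclideanSpace ℝ (Fin m₂)}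
    (hη : η ≠ 0) (h : ‖ζ‖ ^ p ≤ ‖η‖ ^ q) (ω₁ : EuclideanSpace ℝ (Fin m₁))
    (ω₂ : EuclideanSpace ℝ (Fin m₂)) {ε : ℝ} (hε : 0 < ε) :
    ∀ᶠ t : ℝ in nhds 0,
      (γ / 2 * (bellmanWeight p q ‖ζ‖ ‖η‖ * ‖ω₁‖ ^ 2
        + (bellmanWeight p q ‖ζ‖ ‖η‖)⁻¹ * ‖ω₂‖ ^ 2) - ε) * t ^ 2 ≤
      bellmanB p m₁ m₂ (ζ + t • ω₁) (η + t • ω₂) + bellmanB p m₁ m₂ (ζ - t • ω₁) (η - t • ω₂)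
        - 2 * bellmanB p m₁ m₂ ζ η := by
  have h1 := one_lt_conjExponent hp hq
  have h2 := conjExponent_le_two hp hq
  have hγ₀ := bellmanGamma_pos hp hq hγ
  have hγ₁ := bellmanGamma_le hp hq hγ
  have hη' : 0 < ‖η‖ := norm_pos_iff.2 hη
  have hw := bellmanWeight_of_le hp hq (norm_nonneg ζ) (norm_nonneg η) h
  obtain ⟨u, hu⟩ : ∃ u, u = ‖η‖ ^ (q - 2) := ⟨_, rfl⟩
  have hu₀ : 0 < u := by rw [hu]; positivity
  have hsu : ‖ζ‖ ≤ ‖η‖ * u := by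
    refine ((rpow_le_rpow_conj_iff hp hq (norm_nonneg ζ) hη'.le).1 h).trans (le_of_eq ?_)
    rw [hu, mul_comm, ← Real.rpow_add_one hη'.ne']
    congr 1; ring
  have e₁ : (‖η‖ ^ 2) ^ (q / 2 - 1) = u := by
    rw [hu, ← Real.rpow_natCast, ← Real.rpow_mul hη'.le]
    congr 1; push_cast; ring
  have hsub : ∀ x : ℝ, (‖η‖ ^ 2) ^ (x - 1) = (‖η‖ ^ 2) ^ x / ‖η‖ ^ 2 := fun x => by
    rw [Real.rpow_sub_one (by positivity)]
  have e₂ : (‖η‖ ^ 2) ^ (q / 2 - 2) = u / ‖η‖ ^ 2 := by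
    rw [← e₁, ← hsub]; congr 1; ring
  have e₃ : (‖η‖ ^ 2) ^ ((2 - q) / 2) = 1 / u := by
    rw [← e₁, one_div, ← Real.rpow_neg (by positivity)]; congr 1; ring
  have e₄ : (‖η‖ ^ 2) ^ ((2 - q) / 2 - 1) = 1 / (u * ‖η‖ ^ 2) := by
    rw [hsub, e₃, div_div]
  have e₅ : (‖η‖ ^ 2) ^ ((2 - q) / 2 - 2) = 1 / (u * ‖η‖ ^ 4) := by
    rw [show (2 - q) / 2 - 2 = (2 - q) / 2 - 1 - 1 by ring, hsub, e₄, div_div]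
    congr 1; ring
  have e₆ : ‖η‖ ^ (2 - q) = 1 / u := by rw [norm_rpow_eq_sq_rpow, e₃]
  have alg := bellmanHessian_algebra hγ h1 h2 hη' hu₀ (norm_nonneg ζ) hsu (norm_nonneg ω₁)
    (norm_nonneg ω₂) (abs_real_inner_le_norm ζ ω₁) (abs_real_inner_le_norm η ω₂)
  have low : ∀ (ζ : EuclideanSpace ℝ (Fin m₁)) (η : EuclideanSpace ℝ (Fin m₂)),
      1 / 2 * (‖ζ‖ ^ p + ‖η‖ ^ q + γ * (‖ζ‖ ^ 2 * ‖η‖ ^ (2 - q))) ≤ bellmanB p m₁ m₂ ζ η := by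
    intro ζ η
    have := le_betaP hp hq hγ (norm_nonneg ζ) (norm_nonneg η)
    rw [Real.rpow_two] at this
    rw [bellmanB]
    linarith
  have eq : bellmanB p m₁ m₂ ζ η =
      1 / 2 * (‖ζ‖ ^ p + ‖η‖ ^ q + γ * (‖ζ‖ ^ 2 * ‖η‖ ^ (2 - q))) := by
    rw [bellmanB, betaP_def hq hγ, if_pos h, Real.rpow_two]
  filter_upwards [eventually_le_secondDiff_norm_rpow hη ω₂ q hε,
    eventually_le_secondDiff_norm_sq_mul_rpow ζ ω₁ hη ω₂ (2 - q) hε] with t ht₁ ht₂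
  rw [e₁, e₂] at ht₁
  rw [e₃, e₄, e₅] at ht₂
  have l₁ := low (ζ + t • ω₁) (η + t • ω₂)
  have l₂ := low (ζ - t • ω₁) (η - t • ω₂)
  have l₃ := le_secondDiff_norm_rpow hp ζ ω₁ t
  have l₄ : 0 ≤ p * ‖ζ‖ ^ (p - 2) * ‖ω₁‖ ^ 2 * t ^ 2 := by positivity
  have l₅ := mul_le_mul_of_nonneg_left ht₂ hγ₀.le
  have l₆ := mul_le_mul_of_nonneg_right alg (sq_nonneg t)
  have l₇ : γ * (ε * t ^ 2) ≤ 1 * (ε * t ^ 2) := by gcongr; linarith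
  rw [hw, eq, e₆, show γ / 2 * (1 / u * ‖ω₁‖ ^ 2 + (1 / u)⁻¹ * ‖ω₂‖ ^ 2) =
    1 / 2 * (γ * (‖ω₁‖ ^ 2 / u + u * ‖ω₂‖ ^ 2)) by field_simp]
  rw [e₆] at l₅
  linarith

theorem eventually_le_bellmanB_secondDiff (hp : 2 ≤ p) (hq : q = p / (p - 1))
    (hγ : γ = q * (q - 1) / 8) (ζ : EuclideanSpace ℝ (Fin m₁)) {η : EuclideanSpace ℝ (Fin m₂)}
    (hη : η ≠ 0) (ω₁ : EuclideanSpace ℝ (Fin m₁)) (ω₂ : EuclideanSpace ℝ (Fin m₂)) {ε : ℝ}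
    (hε : 0 < ε) :
    ∀ᶠ t : ℝ in nhds 0,
      (γ / 2 * (bellmanWeight p q ‖ζ‖ ‖η‖ * ‖ω₁‖ ^ 2
        + (bellmanWeight p q ‖ζ‖ ‖η‖)⁻¹ * ‖ω₂‖ ^ 2) - ε) * t ^ 2 ≤
      bellmanB p m₁ m₂ (ζ + t • ω₁) (η + t • ω₂) + bellmanB p m₁ m₂ (ζ - t • ω₁) (η - t • ω₂)
        - 2 * bellmanB p m₁ m₂ ζ η := by
  rcases le_or_gt (‖ζ‖ ^ p) (‖η‖ ^ q) with h | h
  · exact eventually_le_bellmanB_secondDiff_of_le hp hq hγ hη h ω₁ ω₂ hε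
  · exact eventually_le_bellmanB_secondDiff_of_gt hp hq hγ hη h ω₁ ω₂ hε

theorem bellmanB_zero_zero (hp : 2 ≤ p) : bellmanB p m₁ m₂ 0 0 = 0 := by
  have h1 := one_lt_conjExponent hp rfl
  refine le_antisymm ?_ (bellmanB_nonneg hp 0 0)
  have := betaP_le_two_mul hp rfl (le_refl (0 : ℝ)) (le_refl (0 : ℝ))
  rw [Real.zero_rpow (by linarith), Real.zero_rpow (by linarith)] at this
  rw [bellmanB, norm_zero, norm_zero]
  linarith

theorem eventually_bellmanB_secondDiff_ge_neg (hp : 2 ≤ p) (ζ : EuclideanSpace ℝ (Fin m₁))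
    (η : EuclideanSpace ℝ (Fin m₂)) (ω₁ : EuclideanSpace ℝ (Fin m₁))
    (ω₂ : EuclideanSpace ℝ (Fin m₂)) {ε : ℝ} (hε : 0 < ε) :
    ∀ᶠ t : ℝ in nhds 0, -ε * t ^ 2 ≤
      bellmanB p m₁ m₂ (ζ + t • ω₁) (η + t • ω₂) + bellmanB p m₁ m₂ (ζ - t • ω₁) (η - t • ω₂)
        - 2 * bellmanB p m₁ m₂ ζ η := by
  obtain ⟨q, hq⟩ : ∃ q, q = p / (p - 1) := ⟨_, rfl⟩
  obtain ⟨γ, hγ⟩ : ∃ γ, γ = q * (q - 1) / 8 := ⟨_, rfl⟩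
  have h1 := one_lt_conjExponent hp hq
  have hγ₀ := bellmanGamma_pos hp hq hγ
  by_cases hη : η = 0
  · subst hη
    by_cases hζ : ζ = 0
    · subst hζ
      refine Filter.Eventually.of_forall fun t => ?_
      rw [bellmanB_zero_zero hp]
      have := bellmanB_nonneg hp (0 + t • ω₁) (0 + t • ω₂)
      have := bellmanB_nonneg hp (0 - t • ω₁) (0 - t • ω₂)
      have : 0 ≤ ε * t ^ 2 := by positivity
      linarith
    · have hζ' : 0 < ‖ζ‖ := norm_pos_iff.2 hζ
      have h : ‖(0 : EuclideanSpace ℝ (Fin m₂))‖ ^ q < ‖ζ‖ ^ p := by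
        rw [norm_zero, Real.zero_rpow (by linarith)]
        positivity
      filter_upwards [eventually_bellmanB_secondDiff_eq hp hq hγ h ω₁ ω₂] with t ht
      rw [ht, norm_zero, Real.zero_rpow (by linarith)]
      have l₃ := le_secondDiff_norm_rpow hp ζ ω₁ t
      have l₄ : 0 ≤ p * ‖ζ‖ ^ (p - 2) * ‖ω₁‖ ^ 2 * t ^ 2 := by positivity
      have hc : 0 ≤ 2 / q - 1 := two_div_conjExponent_sub_one_nonneg hp hq
      have k₁ := mul_nonneg (show 0 ≤ 1 + γ * (2 / p) by positivity) (l₄.trans l₃)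
      have k₂ : 0 ≤ (1 + γ * (2 / q - 1)) *
        (‖0 + t • ω₂‖ ^ q + ‖0 - t • ω₂‖ ^ q - 2 * 0) := by
        rw [mul_zero, sub_zero]; positivity
      have : 0 ≤ ε * t ^ 2 := by positivity
      linarith
  · filter_upwards [eventually_le_bellmanB_secondDiff hp hq hγ ζ hη ω₁ ω₂ hε] with t ht
    refine le_trans ?_ ht
    gcongr
    have := bellmanWeight_nonneg (p := p) (q := q) (s₁ := ‖ζ‖) (norm_nonneg η)
    have : 0 ≤ γ / 2 * (bellmanWeight p q ‖ζ‖ ‖η‖ * ‖ω₁‖ ^ 2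
        + (bellmanWeight p q ‖ζ‖ ‖η‖)⁻¹ * ‖ω₂‖ ^ 2) := by positivity
    linarith

theorem convexOn_bellmanB (hp : 2 ≤ p) :
    ConvexOn ℝ Set.univ fun x : EuclideanSpace ℝ (Fin m₁) × EuclideanSpace ℝ (Fin m₂) =>
      bellmanB p m₁ m₂ x.1 x.2 := by
  refine ⟨convex_univ, fun x _ y _ a b ha hb hab => ?_⟩
  have key := le_chord_of_secondDiff
    (f := fun t : ℝ => bellmanB p m₁ m₂ (x + t • (y - x)).1 (x + t • (y - x)).2)
    ((continuous_bellmanB hp).comp (by fun_prop : Continuous fun t : ℝ => x + t • (y - x)))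
    (fun t ε hε => ?_) (z := b) ⟨hb, by linarith⟩
  · have e : x + b • (y - x) = a • x + b • y := by
      rw [← eq_sub_iff_add_eq] at hab
      rw [hab]; module
    have e₁ : x + (1 : ℝ) • (y - x) = y := by module
    have e₂ : x + (0 : ℝ) • (y - x) = x := by module
    have e₃ : 1 - b = a := by linarith
    simpa only [e, e₁, e₂, e₃, smul_eq_mul] using key
  · filter_upwards [eventually_bellmanB_secondDiff_ge_neg hp (x + t • (y - x)).1
      (x + t • (y - x)).2 (y - x).1 (y - x).2 hε] with s hs
    have e₁ : x + (t + s) • (y - x) = (x + t • (y - x)) + s • (y - x) := by module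
    have e₂ : x + (t - s) • (y - x) = (x + t • (y - x)) - s • (y - x) := by module
    simp only [e₁, e₂]
    exact hs

end LocalConvexity

section Kernel

variable {m₁ m₂ : ℕ} {c κ : ℝ}

/-- The product `ℝ^{m₁} × ℝ^{m₂}` of Euclidean spaces. -/
abbrev EuclProd (m₁ m₂ : ℕ) : Type :=
  EuclideanSpace ℝ (Fin m₁) × EuclideanSpace ℝ (Fin m₂)

instance EuclProd.isAddHaarMeasure_volume :
    (volume : Measure (EuclProd m₁ m₂)).IsAddHaarMeasure :=
  inferInstanceAs (Measure.prod volume volume).IsAddHaarMeasure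

instance EuclProd.isNegInvariant_volume :
    (volume : Measure (EuclProd m₁ m₂)).IsNegInvariant :=
  Measure.IsAddHaarMeasure.isNegInvariant_of_regular _

theorem euclNorm_sq (x : EuclProd m₁ m₂) : euclNorm x ^ 2 = ‖x.1‖ ^ 2 + ‖x.2‖ ^ 2 :=
  Real.sq_sqrt (by positivity)

theorem bumpPsi_eq_expNegInvGlue (x : EuclProd m₁ m₂) :
    bumpPsi m₁ m₂ c x = c * expNegInvGlue (1 - (‖x.1‖ ^ 2 + ‖x.2‖ ^ 2)) := by
  have h0 : 0 ≤ euclNorm x := Real.sqrt_nonneg _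
  rw [bumpPsi, expNegInvGlue, ← euclNorm_sq]
  by_cases h : euclNorm x < 1
  · have : ¬ 1 - euclNorm x ^ 2 ≤ 0 := by nlinarith
    rw [if_pos h, if_neg this, one_div]
  · have : 1 - euclNorm x ^ 2 ≤ 0 := by nlinarith
    rw [if_neg h, if_pos this, mul_zero]

theorem contDiff_bumpPsiK : ContDiff ℝ (⊤ : ℕ∞) (bumpPsiK m₁ m₂ c κ) := by
  have h : ContDiff ℝ (⊤ : ℕ∞) (bumpPsi m₁ m₂ c) := by
    rw [funext (bumpPsi_eq_expNegInvGlue (m₁ := m₁) (m₂ := m₂) (c := c))]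
    refine contDiff_const.mul (expNegInvGlue.contDiff.comp ?_)
    exact contDiff_const.sub ((contDiff_fst.norm_sq ℝ).add (contDiff_snd.norm_sq ℝ))
  exact contDiff_const.mul (h.comp (contDiff_const_smul κ⁻¹))

theorem bumpPsiK_nonneg (hc : 0 < c) (hκ : 0 < κ) (x : EuclProd m₁ m₂) :
    0 ≤ bumpPsiK m₁ m₂ c κ x := by
  rw [bumpPsiK, bumpPsi_eq_expNegInvGlue]
  have := expNegInvGlue.nonneg (1 - (‖(κ⁻¹ • x).1‖ ^ 2 + ‖(κ⁻¹ • x).2‖ ^ 2))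
  positivity

theorem bumpPsiK_congr {x y : EuclProd m₁ m₂} (h₁ : ‖x.1‖ = ‖y.1‖) (h₂ : ‖x.2‖ = ‖y.2‖) :
    bumpPsiK m₁ m₂ c κ x = bumpPsiK m₁ m₂ c κ y := by
  simp only [bumpPsiK, bumpPsi_eq_expNegInvGlue, Prod.smul_fst, Prod.smul_snd, norm_smul, h₁, h₂]

theorem bumpPsiK_eq_zero (hκ : 0 < κ) {x : EuclProd m₁ m₂} (hx : ¬ ‖x‖ ≤ κ) :
    bumpPsiK m₁ m₂ c κ x = 0 := by
  have h : 1 - (‖(κ⁻¹ • x).1‖ ^ 2 + ‖(κ⁻¹ • x).2‖ ^ 2) ≤ 0 := by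
    have aux : ∀ r : ℝ, κ < r → 1 ≤ (κ⁻¹ * r) ^ 2 := fun r hr => by
      refine one_le_pow₀ ?_
      rw [inv_mul_eq_div, one_le_div hκ]
      exact hr.le
    simp only [Prod.smul_fst, Prod.smul_snd, norm_smul, norm_inv, Real.norm_eq_abs, abs_of_pos hκ]
    rw [Prod.norm_def, max_le_iff, not_and_or, not_le, not_le] at hx
    rcases hx with hx | hx
    · have := aux _ hx
      have := sq_nonneg (κ⁻¹ * ‖x.2‖)
      linarith
    · have := aux _ hx
      have := sq_nonneg (κ⁻¹ * ‖x.1‖)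
      linarith
  rw [bumpPsiK, bumpPsi_eq_expNegInvGlue, expNegInvGlue.zero_of_nonpos h, mul_zero, mul_zero]

theorem hasCompactSupport_bumpPsiK (hκ : 0 < κ) :
    HasCompactSupport (bumpPsiK m₁ m₂ c κ) :=
  HasCompactSupport.intro (isCompact_closedBall (0 : EuclProd m₁ m₂) κ) fun x hx =>
    bumpPsiK_eq_zero hκ (by simpa using hx)

theorem integral_bumpPsiK (hκ : 0 < κ) (hnorm : ∫ x, bumpPsi m₁ m₂ c x = 1) :
    ∫ x, bumpPsiK m₁ m₂ c κ x = 1 := by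
  simp only [bumpPsiK]
  rw [integral_const_mul, Measure.integral_comp_smul, hnorm]
  have : Module.finrank ℝ (EuclProd m₁ m₂) = m₁ + m₂ := by simp
  rw [this, inv_pow, inv_inv, abs_of_pos (by positivity), smul_eq_mul, mul_one]
  exact inv_mul_cancel₀ (by positivity)

/-- The average of `f` against the kernel `ψ_κ`. -/
noncomputable def bumpAvg (m₁ m₂ : ℕ) (c κ : ℝ) (f : EuclProd m₁ m₂ → ℝ) : ℝ :=
  ∫ y, f y * bumpPsiK m₁ m₂ c κ y

theorem integrable_mul_bumpPsiK (hκ : 0 < κ) {f : EuclProd m₁ m₂ → ℝ} (hf : Continuous f) :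
    Integrable fun y => f y * bumpPsiK m₁ m₂ c κ y :=
  (hf.mul contDiff_bumpPsiK.continuous).integrable_of_hasCompactSupport
    (hasCompactSupport_bumpPsiK hκ).mul_left

theorem bumpAvg_mono (hc : 0 < c) (hκ : 0 < κ) {f g : EuclProd m₁ m₂ → ℝ} (hf : Continuous f)
    (hg : Continuous g) (h : ∀ y, ‖y.1‖ ≤ κ → ‖y.2‖ ≤ κ → f y ≤ g y) :
    bumpAvg m₁ m₂ c κ f ≤ bumpAvg m₁ m₂ c κ g := by
  refine integral_mono (integrable_mul_bumpPsiK hκ hf) (integrable_mul_bumpPsiK hκ hg) fun y => ?_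
  by_cases hy : ‖y‖ ≤ κ
  · rw [Prod.norm_def, max_le_iff] at hy
    exact mul_le_mul_of_nonneg_right (h y hy.1 hy.2) (bumpPsiK_nonneg hc hκ y)
  · simp [bumpPsiK_eq_zero hκ hy]

theorem bumpAvg_const (hκ : 0 < κ) (hnorm : ∫ x, bumpPsi m₁ m₂ c x = 1) (a : ℝ) :
    bumpAvg m₁ m₂ c κ (fun _ => a) = a := by
  rw [bumpAvg, integral_const_mul, integral_bumpPsiK hκ hnorm, mul_one]

theorem bumpAvg_const_mul (a : ℝ) (f : EuclProd m₁ m₂ → ℝ) :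
    bumpAvg m₁ m₂ c κ (fun y => a * f y) = a * bumpAvg m₁ m₂ c κ f := by
  simp only [bumpAvg, mul_assoc]
  rw [integral_const_mul]

theorem bumpAvg_add (hκ : 0 < κ) {f g : EuclProd m₁ m₂ → ℝ} (hf : Continuous f)
    (hg : Continuous g) :
    bumpAvg m₁ m₂ c κ (fun y => f y + g y) = bumpAvg m₁ m₂ c κ f + bumpAvg m₁ m₂ c κ g := by
  simp only [bumpAvg, add_mul]
  exact integral_add (integrable_mul_bumpPsiK hκ hf) (integrable_mul_bumpPsiK hκ hg)

theorem bumpAvg_comp_neg (f : EuclProd m₁ m₂ → ℝ) :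
    bumpAvg m₁ m₂ c κ (fun y => f (-y)) = bumpAvg m₁ m₂ c κ f := by
  have : ∀ y : EuclProd m₁ m₂, bumpPsiK m₁ m₂ c κ y = bumpPsiK m₁ m₂ c κ (-y) := fun y =>
    bumpPsiK_congr (by simp) (by simp)
  rw [bumpAvg, bumpAvg, ← integral_neg_eq_self]
  simp only [neg_neg]
  simp only [this (-_), neg_neg]

theorem norm_le_bumpAvg_norm_sub (hc : 0 < c) (hκ : 0 < κ)
    (hnorm : ∫ x, bumpPsi m₁ m₂ c x = 1) (η : EuclideanSpace ℝ (Fin m₂)) :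
    ‖η‖ ≤ bumpAvg m₁ m₂ c κ (fun y => ‖η - y.2‖) := by
  have c₁ : Continuous fun y : EuclProd m₁ m₂ => ‖η - y.2‖ := by fun_prop
  have c₂ : Continuous fun y : EuclProd m₁ m₂ => ‖η - (-y).2‖ := by fun_prop
  have h₁ := bumpAvg_comp_neg (c := c) (κ := κ) fun y : EuclProd m₁ m₂ => ‖η - y.2‖
  have h₂ := bumpAvg_add (c := c) hκ c₁ c₂
  have h₃ := bumpAvg_mono hc hκ (f := fun _ => 2 * ‖η‖) continuous_const (c₁.add c₂) fun y _ _ => by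
    have := norm_add_le (η - y.2) (η + y.2)
    rw [sub_add_add_cancel, ← two_smul ℝ, norm_smul, Real.norm_two] at this
    simpa using this
  rw [bumpAvg_const hκ hnorm] at h₃
  change _ ≤ bumpAvg m₁ m₂ c κ (fun y => ‖η - y.2‖ + ‖η - (-y).2‖) at h₃
  linarith

theorem bumpAvg_sub_congr {φ : ℝ → ℝ → ℝ} {ξ ξ' : EuclProd m₁ m₂} (h₁ : ‖ξ.1‖ = ‖ξ'.1‖)
    (h₂ : ‖ξ.2‖ = ‖ξ'.2‖) :
    bumpAvg m₁ m₂ c κ (fun y => φ ‖ξ.1 - y.1‖ ‖ξ.2 - y.2‖) =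
      bumpAvg m₁ m₂ c κ (fun y => φ ‖ξ'.1 - y.1‖ ‖ξ'.2 - y.2‖) := by
  obtain ⟨R₁, hR₁⟩ : ∃ R : EuclideanSpace ℝ (Fin m₁) ≃ₗᵢ[ℝ] EuclideanSpace ℝ (Fin m₁),
      R ξ.1 = ξ'.1 := ⟨_, Submodule.reflection_sub h₁⟩
  obtain ⟨R₂, hR₂⟩ : ∃ R : EuclideanSpace ℝ (Fin m₂) ≃ₗᵢ[ℝ] EuclideanSpace ℝ (Fin m₂),
      R ξ.2 = ξ'.2 := ⟨_, Submodule.reflection_sub h₂⟩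
  have mp : MeasurePreserving (Prod.map R₁ R₂) (volume : Measure (EuclProd m₁ m₂)) volume :=
    R₁.measurePreserving.prod R₂.measurePreserving
  have me : MeasurableEmbedding (Prod.map R₁ R₂ : EuclProd m₁ m₂ → EuclProd m₁ m₂) :=
    (R₁.toHomeomorph.prodCongr R₂.toHomeomorph).measurableEmbedding
  rw [bumpAvg, bumpAvg, ← mp.integral_comp me
    (fun y => φ ‖ξ'.1 - y.1‖ ‖ξ'.2 - y.2‖ * bumpPsiK m₁ m₂ c κ y)]
  refine integral_congr_ae (Filter.Eventually.of_forall fun y => ?_)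
  have e₁ : ‖ξ'.1 - R₁ y.1‖ = ‖ξ.1 - y.1‖ := by rw [← hR₁, ← map_sub, R₁.norm_map]
  have e₂ : ‖ξ'.2 - R₂ y.2‖ = ‖ξ.2 - y.2‖ := by rw [← hR₂, ← map_sub, R₂.norm_map]
  simp only [Prod.map_fst, Prod.map_snd, e₁, e₂]
  rw [bumpPsiK_congr (x := y) (y := Prod.map R₁ R₂ y) (by simp) (by simp)]

theorem ae_sub_snd_ne_zero (hm₂ : 0 < m₂) (η : EuclideanSpace ℝ (Fin m₂)) :
    ∀ᵐ y : EuclProd m₁ m₂, η - y.2 ≠ 0 := by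
  have : Nonempty (Fin m₂) := ⟨⟨0, hm₂⟩⟩
  have : {y : EuclProd m₁ m₂ | ¬ (η - y.2 ≠ 0)} = Set.univ ×ˢ {η} := by
    ext y
    simp [sub_eq_zero, eq_comm]
  rw [ae_iff, this, Measure.volume_eq_prod, Measure.prod_prod]
  simp

theorem regBellman_eq_bumpAvg (p : ℝ) (x : EuclProd m₁ m₂) :
    regBellman p m₁ m₂ c κ x =
      bumpAvg m₁ m₂ c κ (fun y => bellmanB p m₁ m₂ (x.1 - y.1) (x.2 - y.2)) := by
  rw [regBellman, bumpAvg, ← integral_sub_left_eq_self _ _ x]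
  simp only [sub_sub_cancel, Prod.fst_sub, Prod.snd_sub]

end Kernel

section Regularization

variable {m₁ m₂ : ℕ} {c κ p q γ : ℝ}

theorem contDiff_regBellman (hp : 2 ≤ p) (hκ : 0 < κ) :
    ContDiff ℝ (⊤ : ℕ∞) (regBellman p m₁ m₂ c κ) :=
  (hasCompactSupport_bumpPsiK hκ).contDiff_convolution_right (ContinuousLinearMap.mul ℝ ℝ)
    (continuous_bellmanB hp).locallyIntegrable contDiff_bumpPsiK

theorem continuous_bellmanB_sub (hp : 2 ≤ p) (x : EuclProd m₁ m₂) :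
    Continuous fun y : EuclProd m₁ m₂ => bellmanB p m₁ m₂ (x.1 - y.1) (x.2 - y.2) := by
  have hs : Continuous fun y : EuclProd m₁ m₂ => x - y := by fun_prop
  have h := (continuous_bellmanB (m₁ := m₁) (m₂ := m₂) hp).comp hs
  simpa only [Function.comp_def, Prod.fst_sub, Prod.snd_sub] using h

theorem continuous_bellmanWeight_sub (hp : 2 ≤ p) (hq : q = p / (p - 1)) (x : EuclProd m₁ m₂) :
    Continuous fun y : EuclProd m₁ m₂ => bellmanWeight p q ‖x.1 - y.1‖ ‖x.2 - y.2‖ :=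
  continuous_bellmanWeight_comp hp hq (by fun_prop) (by fun_prop)

theorem convexOn_regBellman (hp : 2 ≤ p) (hc : 0 < c) (hκ : 0 < κ) :
    ConvexOn ℝ Set.univ (regBellman p m₁ m₂ c κ) := by
  refine ⟨convex_univ, fun x _ z _ a b ha hb hab => ?_⟩
  simp only [regBellman_eq_bumpAvg, smul_eq_mul, ← bumpAvg_const_mul]
  have c₁ := (continuous_bellmanB_sub hp x).const_mul a
  have c₂ := (continuous_bellmanB_sub hp z).const_mul b
  rw [← bumpAvg_add hκ c₁ c₂]
  refine bumpAvg_mono hc hκ (continuous_bellmanB_sub hp _) (c₁.add c₂) fun y _ _ => ?_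
  have h := (convexOn_bellmanB hp).2 (Set.mem_univ (x - y)) (Set.mem_univ (z - y)) ha hb hab
  have e : a • (x - y) + b • (z - y) = a • x + b • z - y := by
    rw [smul_sub, smul_sub, sub_add_sub_comm, ← add_smul, hab, one_smul]
  rw [e] at h
  exact h

/-- The weight `τ_κ`: the average of the Bellman weight against `ψ_κ`. -/
noncomputable def weightAvg (p q : ℝ) (m₁ m₂ : ℕ) (c κ : ℝ) (x : EuclProd m₁ m₂) : ℝ :=
  bumpAvg m₁ m₂ c κ fun y => bellmanWeight p q ‖x.1 - y.1‖ ‖x.2 - y.2‖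

theorem weightAvg_congr {x x' : EuclProd m₁ m₂} (h₁ : ‖x.1‖ = ‖x'.1‖) (h₂ : ‖x.2‖ = ‖x'.2‖) :
    weightAvg p q m₁ m₂ c κ x = weightAvg p q m₁ m₂ c κ x' :=
  bumpAvg_sub_congr h₁ h₂

theorem weightAvg_pos (hp : 2 ≤ p) (hq : q = p / (p - 1)) (hc : 0 < c) (hκ : 0 < κ)
    (hnorm : ∫ x, bumpPsi m₁ m₂ c x = 1) (hm₂ : 0 < m₂) (x : EuclProd m₁ m₂) :
    0 < weightAvg p q m₁ m₂ c κ x := by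
  have h0 : 0 ≤ fun y : EuclProd m₁ m₂ =>
      bellmanWeight p q ‖x.1 - y.1‖ ‖x.2 - y.2‖ * bumpPsiK m₁ m₂ c κ y := fun y =>
    mul_nonneg (bellmanWeight_nonneg (norm_nonneg _)) (bumpPsiK_nonneg hc hκ y)
  refine lt_of_le_of_ne (integral_nonneg h0) fun h => ?_
  have h1 := (integral_eq_zero_iff_of_nonneg h0
    (integrable_mul_bumpPsiK hκ (continuous_bellmanWeight_sub hp hq x))).1 h.symm
  have h2 : bumpPsiK m₁ m₂ c κ =ᵐ[volume] 0 := by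
    filter_upwards [h1, ae_sub_snd_ne_zero hm₂ x.2] with y hy hy'
    exact (mul_eq_zero.1 hy).resolve_left (bellmanWeight_pos (norm_pos_iff.2 hy')).ne'
  have h3 := integral_bumpPsiK hκ hnorm
  rw [integral_congr_ae h2] at h3
  simp at h3

/-- Averaging the second-order bound for the Bellman function yields the Hessian bound. -/
theorem le_fderiv_fderiv_regBellman (hp : 2 ≤ p) (hq : q = p / (p - 1))
    (hγ : γ = q * (q - 1) / 8) (hc : 0 < c) (hκ : 0 < κ) (hnorm : ∫ x, bumpPsi m₁ m₂ c x = 1)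
    (hm₂ : 0 < m₂) (x w : EuclProd m₁ m₂) :
    γ / 2 * (weightAvg p q m₁ m₂ c κ x * ‖w.1‖ ^ 2 + (weightAvg p q m₁ m₂ c κ x)⁻¹ * ‖w.2‖ ^ 2) ≤
      fderiv ℝ (fderiv ℝ (regBellman p m₁ m₂ c κ)) x w w := by
  set F := regBellman p m₁ m₂ c κ with hF
  have hγ0 := bellmanGamma_pos hp hq hγ
  have hsm : ContDiff ℝ (⊤ : ℕ∞) F := contDiff_regBellman hp hκ
  set Q := fderiv ℝ (fderiv ℝ F) x w w with hQ
  have hA := weightAvg_pos (c := c) hp hq hc hκ hnorm hm₂ x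
  set A := weightAvg p q m₁ m₂ c κ x with hAdef
  have hline : ∀ t : ℝ, HasDerivAt (fun t : ℝ => x + t • w) w t := fun t => by
    simpa using ((hasDerivAt_id t).smul_const w).const_add x
  have h₁ : ∀ t : ℝ, HasDerivAt (fun t : ℝ => F (x + t • w)) (fderiv ℝ F (x + t • w) w) t :=
    fun t => ((hsm.differentiable (by simp)) _).hasFDerivAt.comp_hasDerivAt t (hline t)
  have h₂ : HasDerivAt (fun t : ℝ => fderiv ℝ F (x + t • w) w) Q 0 := by
    have d : Differentiable ℝ (fderiv ℝ F) :=
      (hsm.fderiv_right (m := 1) (WithTop.coe_le_coe.2 le_top)).differentiable (by simp)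
    have := (d (x + (0 : ℝ) • w)).hasFDerivAt.comp_hasDerivAt (0 : ℝ) (hline 0)
    have := this.clm_apply (hasDerivAt_const (0 : ℝ) w)
    simpa [hQ] using this
  let t : ℕ → ℝ := fun n => 1 / ((n : ℝ) + 1)
  have ht0 : ∀ n, t n ≠ 0 := fun n => (by positivity : (0 : ℝ) < 1 / ((n : ℝ) + 1)).ne'
  have ht : Filter.Tendsto t Filter.atTop (nhds 0) := tendsto_one_div_add_atTop_nhds_zero_nat
  let D : ℕ → EuclProd m₁ m₂ → ℝ := fun n y =>
    (bellmanB p m₁ m₂ ((x + t n • w).1 - y.1) ((x + t n • w).2 - y.2)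
      + bellmanB p m₁ m₂ ((x - t n • w).1 - y.1) ((x - t n • w).2 - y.2)
      - 2 * bellmanB p m₁ m₂ (x.1 - y.1) (x.2 - y.2)) / t n ^ 2
  let R : EuclProd m₁ m₂ → ℝ := fun y =>
    γ / 2 * (bellmanWeight p q ‖x.1 - y.1‖ ‖x.2 - y.2‖ * ‖w.1‖ ^ 2
      + (2 * A⁻¹ - A⁻¹ ^ 2 * bellmanWeight p q ‖x.1 - y.1‖ ‖x.2 - y.2‖) * ‖w.2‖ ^ 2)
  have hWc := continuous_bellmanWeight_sub hp hq x
  have hDc : ∀ n, Continuous (D n) := fun n =>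
    (((continuous_bellmanB_sub hp _).add (continuous_bellmanB_sub hp _)).sub
      ((continuous_bellmanB_sub hp x).const_mul 2)).div_const _
  have hRc : Continuous R := by fun_prop
  have hD0 : ∀ n y, 0 ≤ D n y := fun n y => by
    have h := (convexOn_bellmanB hp).2 (Set.mem_univ (x + t n • w - y))
      (Set.mem_univ (x - t n • w - y)) (by norm_num : (0 : ℝ) ≤ 1 / 2)
      (by norm_num : (0 : ℝ) ≤ 1 / 2) (by norm_num)
    have e : (1 / 2 : ℝ) • (x + t n • w - y) + (1 / 2 : ℝ) • (x - t n • w - y) = x - y := by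
      module
    rw [e, smul_eq_mul, smul_eq_mul] at h
    simp only [Prod.fst_sub, Prod.snd_sub] at h
    refine div_nonneg ?_ (sq_nonneg _)
    simp only [Prod.fst_sub, Prod.snd_sub]
    linarith
  have hDavg : ∀ n, bumpAvg m₁ m₂ c κ (D n) =
      (F (x + t n • w) + F (x - t n • w) - 2 * F x) / t n ^ 2 := fun n => by
    have i := fun z : EuclProd m₁ m₂ =>
      integrable_mul_bumpPsiK (c := c) hκ (continuous_bellmanB_sub hp z)
    simp only [hF, regBellman_eq_bumpAvg, bumpAvg]
    rw [← integral_add (i _) (i _), ← integral_const_mul, ← integral_sub _ ((i x).const_mul 2),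
      ← integral_div]
    swap
    · exact (i _).add (i _)
    refine integral_congr_ae (Filter.Eventually.of_forall fun y => ?_)
    simp only [D]
    ring
  have hRavg : bumpAvg m₁ m₂ c κ R = γ / 2 * (A * ‖w.1‖ ^ 2 + A⁻¹ * ‖w.2‖ ^ 2) := by
    have e : R = fun y => γ / 2 * (‖w.1‖ ^ 2 - A⁻¹ ^ 2 * ‖w.2‖ ^ 2) *
        bellmanWeight p q ‖x.1 - y.1‖ ‖x.2 - y.2‖ + γ / 2 * (2 * A⁻¹ * ‖w.2‖ ^ 2) := by
      ext y
      simp only [R]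
      ring
    rw [e, bumpAvg_add hκ (hWc.const_mul _) continuous_const, bumpAvg_const_mul,
      bumpAvg_const hκ hnorm]
    change _ * A + _ = _
    field_simp
    ring
  have hlimQ : Filter.Tendsto (fun n => bumpAvg m₁ m₂ c κ (D n)) Filter.atTop (nhds Q) := by
    have h := ((isLittleO_secondDiff (Filter.Eventually.of_forall h₁) h₂).comp_tendsto
      ht).tendsto_div_nhds_zero.add_const Q
    rw [zero_add] at h
    refine h.congr fun n => ?_
    have := ht0 n
    simp only [hDavg, Function.comp, neg_smul, ← sub_eq_add_neg, zero_smul, add_zero]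
    field_simp
    ring
  have hlimR : Filter.Tendsto (fun n => bumpAvg m₁ m₂ c κ fun y => min (D n y) (R y))
      Filter.atTop (nhds (bumpAvg m₁ m₂ c κ R)) := by
    refine tendsto_integral_of_dominated_convergence (fun y => |R y| * bumpPsiK m₁ m₂ c κ y)
      (fun n => (integrable_mul_bumpPsiK hκ ((hDc n).min hRc)).aestronglyMeasurable)
      (integrable_mul_bumpPsiK hκ hRc.abs)
      (fun n => Filter.Eventually.of_forall fun y => ?_) ?_
    · rw [norm_mul, Real.norm_of_nonneg (bumpPsiK_nonneg hc hκ y), Real.norm_eq_abs]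
      refine mul_le_mul_of_nonneg_right (abs_le.2 ⟨?_, ?_⟩) (bumpPsiK_nonneg hc hκ y)
      · exact le_min ((neg_nonpos.2 (abs_nonneg _)).trans (hD0 n y)) (neg_abs_le _)
      · exact (min_le_right _ _).trans (le_abs_self _)
    · filter_upwards [ae_sub_snd_ne_zero hm₂ x.2] with y hy
      refine Filter.Tendsto.mul_const _ ?_
      have hτ : 0 < bellmanWeight p q ‖x.1 - y.1‖ ‖x.2 - y.2‖ :=
        bellmanWeight_pos (norm_pos_iff.2 hy)
      set T := bellmanWeight p q ‖x.1 - y.1‖ ‖x.2 - y.2‖ with hT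
      have hRle : R y ≤ γ / 2 * (T * ‖w.1‖ ^ 2 + T⁻¹ * ‖w.2‖ ^ 2) := by
        have : 2 * A⁻¹ - A⁻¹ ^ 2 * T ≤ T⁻¹ := by
          have e : T⁻¹ - (2 * A⁻¹ - A⁻¹ ^ 2 * T) = T * (T⁻¹ - A⁻¹) ^ 2 := by
            field_simp
            ring
          have : 0 ≤ T * (T⁻¹ - A⁻¹) ^ 2 := by positivity
          linarith
        simp only [R, ← hT]
        gcongr
      rw [tendsto_order]
      refine ⟨fun a ha => ?_, fun a ha =>
        Filter.Eventually.of_forall fun n => (min_le_right _ _).trans_lt ha⟩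
      have ev := ht.eventually (eventually_le_bellmanB_secondDiff hp hq hγ (x.1 - y.1) hy w.1 w.2
        (half_pos (sub_pos.2 ha)))
      filter_upwards [ev] with n hn
      refine lt_min ?_ ha
      have ht2 : 0 < t n ^ 2 := by have := ht0 n; positivity
      simp only [D]
      rw [lt_div_iff₀ ht2]
      simp only [Prod.fst_add, Prod.snd_add, Prod.fst_sub, Prod.snd_sub, Prod.smul_fst,
        Prod.smul_snd]
      rw [add_sub_right_comm x.1, add_sub_right_comm x.2, sub_right_comm _ _ y.1,
        sub_right_comm _ _ y.2]
      refine lt_of_lt_of_le (mul_lt_mul_of_pos_right ?_ ht2) hn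
      linarith
  rw [← hRavg]
  exact le_of_tendsto_of_tendsto' hlimR hlimQ fun n =>
    bumpAvg_mono hc hκ ((hDc n).min hRc) (hDc n) fun y _ _ => min_le_left _ _

/-- Convexity along the ray through `x`. -/
theorem sub_le_fderiv_regBellman (hp : 2 ≤ p) (hc : 0 < c) (hκ : 0 < κ) (x : EuclProd m₁ m₂) :
    regBellman p m₁ m₂ c κ x - regBellman p m₁ m₂ c κ 0 ≤
      fderiv ℝ (regBellman p m₁ m₂ c κ) x x := by
  have hcv := (convexOn_regBellman (m₁ := m₁) (m₂ := m₂) hp hc hκ).comp_linearMap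
    (LinearMap.toSpanSingleton ℝ (EuclProd m₁ m₂) x)
  have hd : HasDerivAt (fun t : ℝ => regBellman p m₁ m₂ c κ (t • x))
      (fderiv ℝ (regBellman p m₁ m₂ c κ) x x) 1 := by
    have hline : HasDerivAt (fun t : ℝ => t • x) x 1 := by
      simpa using (hasDerivAt_id (1 : ℝ)).smul_const x
    have := (((contDiff_regBellman (c := c) hp hκ).differentiable (by simp))
      ((1 : ℝ) • x)).hasFDerivAt.comp_hasDerivAt (1 : ℝ) hline
    rwa [one_smul] at this
  have := hcv.slope_le_of_hasDerivAt (x := (0 : ℝ)) (y := 1) trivial trivial zero_lt_one hd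
  simpa [slope_def_field] using this

theorem regBellman_zero_le (hp : 2 ≤ p) (hq : q = p / (p - 1)) (hc : 0 < c) (hκ : 0 < κ)
    (hκ₁ : κ < 1) (hnorm : ∫ x, bumpPsi m₁ m₂ c x = 1) :
    regBellman p m₁ m₂ c κ 0 ≤ 2 * κ ^ q := by
  have h1 := one_lt_conjExponent hp hq
  have h2 := conjExponent_le_two hp hq
  rw [regBellman_eq_bumpAvg, ← bumpAvg_const (m₁ := m₁) (m₂ := m₂) hκ hnorm (2 * κ ^ q)]
  refine bumpAvg_mono hc hκ (continuous_bellmanB_sub hp 0) continuous_const fun y h₁ h₂ => ?_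
  have hb := betaP_le_two_mul hp hq (norm_nonneg y.1) (norm_nonneg y.2)
  have e₁ : ‖y.1‖ ^ p ≤ κ ^ q :=
    (Real.rpow_le_rpow (norm_nonneg _) h₁ (by linarith)).trans
      (Real.rpow_le_rpow_of_exponent_ge hκ hκ₁.le (by linarith))
  have e₂ : ‖y.2‖ ^ q ≤ κ ^ q := Real.rpow_le_rpow (norm_nonneg _) h₂ (by linarith)
  simp only [bellmanB, Prod.fst_zero, Prod.snd_zero, zero_sub, norm_neg]
  linarith

theorem weightAvg_le (hp : 2 ≤ p) (hq : q = p / (p - 1)) (hc : 0 < c) (hκ : 0 < κ)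
    (hnorm : ∫ x, bumpPsi m₁ m₂ c x = 1) (x : EuclProd m₁ m₂) :
    weightAvg p q m₁ m₂ c κ x ≤ (‖x.1‖ + κ) ^ (p - 2) + (‖x.2‖ + κ) ^ (2 - q) := by
  have h2 := conjExponent_le_two hp hq
  rw [weightAvg, ← bumpAvg_const (m₁ := m₁) (m₂ := m₂) hκ hnorm (_ + _)]
  refine bumpAvg_mono hc hκ (continuous_bellmanWeight_sub hp hq x) continuous_const
    fun y h₁ h₂ => ?_
  refine (max_le_add_of_nonneg (by positivity) (by positivity)).trans (add_le_add ?_ ?_)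
  · exact Real.rpow_le_rpow (norm_nonneg _) ((norm_sub_le _ _).trans (by linarith)) (by linarith)
  · exact Real.rpow_le_rpow (norm_nonneg _) ((norm_sub_le _ _).trans (by linarith)) (by linarith)

/-- A lower bound for `B_κ` with an error controlled by the averaged weight. -/
theorem sub_weightAvg_le_regBellman (hp : 2 ≤ p) (hq : q = p / (p - 1))
    (hγ : γ = q * (q - 1) / 8) (hc : 0 < c) (hκ : 0 < κ) (hnorm : ∫ x, bumpPsi m₁ m₂ c x = 1)
    (hm₂ : 0 < m₂) (x : EuclProd m₁ m₂) :
    γ / 2 * (weightAvg p q m₁ m₂ c κ x * ‖x.1‖ ^ 2 + (weightAvg p q m₁ m₂ c κ x)⁻¹ * ‖x.2‖ ^ 2)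
      - γ * κ ^ 2 * weightAvg p q m₁ m₂ c κ x ≤ regBellman p m₁ m₂ c κ x := by
  have hγ0 := bellmanGamma_pos hp hq hγ
  have hγ4 := bellmanGamma_le hp hq hγ
  have hA := weightAvg_pos (c := c) hp hq hc hκ hnorm hm₂ x
  have hWc := continuous_bellmanWeight_sub hp hq x
  have hNc : Continuous fun y : EuclProd m₁ m₂ => ‖x.2 - y.2‖ := by fun_prop
  have hN := norm_le_bumpAvg_norm_sub (m₁ := m₁) hc hκ hnorm x.2
  set A := weightAvg p q m₁ m₂ c κ x with hAdef
  set a := ‖x.2‖ / A with ha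
  have ha0 : 0 ≤ a := by positivity
  have key := bumpAvg_mono hc hκ
    (f := fun y => γ * (‖x.1‖ ^ 2 / 2 - κ ^ 2 - a ^ 2 / 2) *
      bellmanWeight p q ‖x.1 - y.1‖ ‖x.2 - y.2‖ + γ * a * ‖x.2 - y.2‖)
    ((hWc.const_mul _).add (hNc.const_mul _)) (continuous_bellmanB_sub hp x) fun y h₁ h₂ => by
      have n₁ := norm_nonneg (x.1 - y.1)
      have n₂ := norm_nonneg (x.2 - y.2)
      have b₁ := add_rpow_le_betaP hp hq n₁ n₂
      have b₂ := bellmanWeight_mul_sq_le hp hq n₁ n₂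
      have b₃ := two_mul_sub_sq_mul_bellmanWeight_le hp hq (s₁ := ‖x.1 - y.1‖) n₂ a
      have b₄ : ‖x.1‖ ^ 2 / 2 - κ ^ 2 ≤ ‖x.1 - y.1‖ ^ 2 := by
        have : ‖x.1‖ ≤ ‖x.1 - y.1‖ + κ := by
          have := norm_add_le (x.1 - y.1) y.1
          rw [sub_add_cancel] at this
          linarith
        nlinarith [sq_nonneg (‖x.1 - y.1‖ - κ), norm_nonneg x.1]
      have b₅ := bellmanWeight_nonneg (p := p) (q := q) (s₁ := ‖x.1 - y.1‖) n₂
      have b₆ : 0 ≤ ‖x.1 - y.1‖ ^ p := by positivity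
      have b₇ : 0 ≤ ‖x.2 - y.2‖ ^ q := by positivity
      have b₈ := mul_le_mul_of_nonneg_right b₄ b₅
      simp only [bellmanB]
      set T := bellmanWeight p q ‖x.1 - y.1‖ ‖x.2 - y.2‖
      nlinarith
  rw [bumpAvg_add hκ (hWc.const_mul _) (hNc.const_mul _), bumpAvg_const_mul, bumpAvg_const_mul,
    ← regBellman_eq_bumpAvg] at key
  change _ * A + _ ≤ _ at key
  have h3 := mul_le_mul_of_nonneg_left hN (mul_nonneg hγ0.le ha0)
  have e₁ : a * ‖x.2‖ = A⁻¹ * ‖x.2‖ ^ 2 := by rw [ha]; field_simp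
  have e₂ : a ^ 2 * A = A⁻¹ * ‖x.2‖ ^ 2 := by rw [ha]; field_simp
  nlinarith

theorem error_le (hp : 2 ≤ p) (hq : q = p / (p - 1)) (hγ : γ = q * (q - 1) / 8) (hκ : 0 < κ)
    (hκ₁ : κ < 1) {u v : ℝ} (hu : 0 ≤ u) (hv : 0 ≤ v) :
    γ * κ ^ 2 * ((u + κ) ^ (p - 2) + (v + κ) ^ (2 - q)) + 2 * κ ^ q ≤
      κ * ((2 ^ (p - 1) + 4) * (u ^ (p - 1) + v + v ^ (q - 1) + κ ^ (q - 1))) := by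
  have hγ0 := bellmanGamma_pos hp hq hγ
  have hγ4 := bellmanGamma_le hp hq hγ
  have h1 := one_lt_conjExponent hp hq
  have h2 := conjExponent_le_two hp hq
  have e₁ : κ ^ q = κ * κ ^ (q - 1) := by
    rw [← Real.rpow_one_add' hκ.le (by linarith), add_sub_cancel]
  have e₂ : κ * (u + κ) ^ (p - 2) ≤ 2 ^ (p - 1) * (u ^ (p - 1) + κ ^ (q - 1)) := by
    calc κ * (u + κ) ^ (p - 2) ≤ (u + κ) * (u + κ) ^ (p - 2) := by gcongr; linarith
      _ = (u + κ) ^ (p - 1) := by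
        rw [← Real.rpow_one_add' (by positivity) (by linarith)]; ring_nf
      _ ≤ 2 ^ (p - 1) * (u ^ (p - 1) + κ ^ (p - 1)) := by
        rw [mul_add, ← Real.mul_rpow two_pos.le hu, ← Real.mul_rpow two_pos.le hκ.le]
        have a₁ : 0 ≤ (2 * u) ^ (p - 1) := by positivity
        have a₂ : 0 ≤ (2 * κ) ^ (p - 1) := by positivity
        rcases le_total u κ with h | h
        · have := Real.rpow_le_rpow (z := p - 1) (by positivity)
            (by linarith : u + κ ≤ 2 * κ) (by linarith)
          linarith
        · have := Real.rpow_le_rpow (z := p - 1) (by positivity)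
            (by linarith : u + κ ≤ 2 * u) (by linarith)
          linarith
      _ ≤ _ := by
        have := Real.rpow_le_rpow_of_exponent_ge hκ hκ₁.le (by linarith : q - 1 ≤ p - 1)
        gcongr
  have e₃ : κ * (v + κ) ^ (2 - q) ≤ v + 2 * κ ^ (q - 1) := by
    have a₁ : (v + κ) ^ (2 - q) ≤ 1 + (v + κ) := by
      rcases le_total (v + κ) 1 with h | h
      · have := Real.rpow_le_one (z := 2 - q) (by positivity) h (by linarith)
        linarith
      · have := Real.rpow_le_rpow_of_exponent_le h (by linarith : 2 - q ≤ 1)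
        rw [Real.rpow_one] at this
        linarith
    have a₂ : κ ≤ κ ^ (q - 1) := by
      have := Real.rpow_le_rpow_of_exponent_ge hκ hκ₁.le (by linarith : q - 1 ≤ 1)
      rwa [Real.rpow_one] at this
    nlinarith
  have n₁ : 0 ≤ u ^ (p - 1) := by positivity
  have n₂ : 0 ≤ v ^ (q - 1) := by positivity
  have n₃ : 0 ≤ κ ^ (q - 1) := by positivity
  have n₄ : (0 : ℝ) ≤ 2 ^ (p - 1) := by positivity
  have e₄ : γ * (κ * (u + κ) ^ (p - 2) + κ * (v + κ) ^ (2 - q)) ≤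
      1 / 4 * (κ * (u + κ) ^ (p - 2) + κ * (v + κ) ^ (2 - q)) := by gcongr
  have e₅ : γ * (κ * (u + κ) ^ (p - 2) + κ * (v + κ) ^ (2 - q)) + 2 * κ ^ (q - 1) ≤
      (2 ^ (p - 1) + 4) * (u ^ (p - 1) + v + v ^ (q - 1) + κ ^ (q - 1)) := by
    have m₁ := mul_nonneg n₄ n₁
    have m₂ := mul_nonneg n₄ n₂
    have m₃ := mul_nonneg n₄ n₃
    have m₄ := mul_nonneg n₄ hv
    nlinarith
  have := mul_le_mul_of_nonneg_left e₅ hκ.le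
  rw [e₁]
  linarith

end Regularization

/-- For `p ≥ 2`, `q = p/(p−1)`, `γ = q(q−1)/8`, positive `m₁, m₂`,
the regularized Bellman function `B_κ = B * ψ_κ` is `C^∞` for every `κ ∈ (0,1)`, and
there is a constant `C > 0` (depending only on `m₁, m₂, p`) such that for every
`κ ∈ (0,1)` there exist `τ_κ : [0,∞)² → (0,∞)` and a continuous `E_κ` with, for all
`ξ = (ζ,η)` and `τ = τ_κ(|ζ|,|η|)`:
(i) `⟨Hess(B_κ)(ξ)ω, ω⟩ ≥ (γ/2)(τ|ω₁|² + τ⁻¹|ω₂|²)` for all `ω = (ω₁,ω₂)`;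
(ii) `⟨∇B_κ(ξ), ξ⟩ ≥ (γ/2)(τ|ζ|² + τ⁻¹|η|²) − κ E_κ(ξ)`;
(iii) `|E_κ(ξ)| ≤ C(|ζ|^{p−1} + |η| + |η|^{q−1} + κ^{q−1})`.
Here `⟨∇B_κ(ξ), ξ⟩` is written as `fderiv ℝ B_κ ξ ξ` and `⟨Hess(B_κ)(ξ)ω, ω⟩` as
`fderiv ℝ (fderiv ℝ B_κ) ξ ω ω`. -/
theorem regBellman_convexity_properties (p q γ : ℝ) (hp : 2 ≤ p)
    (hq : q = p / (p - 1)) (hγ : γ = q * (q - 1) / 8)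
    (m₁ m₂ : ℕ) (hm₁ : 0 < m₁) (hm₂ : 0 < m₂)
    (c : ℝ) (hc : 0 < c) (hnorm : ∫ x, bumpPsi m₁ m₂ c x = 1) :
    (∀ κ ∈ Set.Ioo (0 : ℝ) 1, ContDiff ℝ (⊤ : ℕ∞) (regBellman p m₁ m₂ c κ)) ∧
    ∃ C : ℝ, 0 < C ∧
      ∀ κ ∈ Set.Ioo (0 : ℝ) 1,
        ∃ τ : ℝ → ℝ → ℝ, (∀ s₁ s₂ : ℝ, 0 ≤ s₁ → 0 ≤ s₂ → 0 < τ s₁ s₂) ∧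
          ∃ E : EuclideanSpace ℝ (Fin m₁) × EuclideanSpace ℝ (Fin m₂) → ℝ,
            Continuous E ∧
            ∀ (ζ : EuclideanSpace ℝ (Fin m₁)) (η : EuclideanSpace ℝ (Fin m₂)),
              (∀ (ω₁ : EuclideanSpace ℝ (Fin m₁)) (ω₂ : EuclideanSpace ℝ (Fin m₂)),
                γ / 2 * (τ ‖ζ‖ ‖η‖ * ‖ω₁‖ ^ 2 + (τ ‖ζ‖ ‖η‖)⁻¹ * ‖ω₂‖ ^ 2) ≤
                  fderiv ℝ (fderiv ℝ (regBellman p m₁ m₂ c κ)) (ζ, η) (ω₁, ω₂) (ω₁, ω₂)) ∧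
              (γ / 2 * (τ ‖ζ‖ ‖η‖ * ‖ζ‖ ^ 2 + (τ ‖ζ‖ ‖η‖)⁻¹ * ‖η‖ ^ 2) - κ * E (ζ, η) ≤
                fderiv ℝ (regBellman p m₁ m₂ c κ) (ζ, η) (ζ, η)) ∧
              |E (ζ, η)| ≤
                C * (‖ζ‖ ^ (p - 1) + ‖η‖ + ‖η‖ ^ (q - 1) + κ ^ (q - 1)) := by
  refine ⟨fun κ hκ => contDiff_regBellman hp hκ.1, 2 ^ (p - 1) + 4, by positivity,
    fun κ hκ => ?_⟩
  let v₁ : ℝ → EuclideanSpace ℝ (Fin m₁) := EuclideanSpace.single ⟨0, hm₁⟩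
  let v₂ : ℝ → EuclideanSpace ℝ (Fin m₂) := EuclideanSpace.single ⟨0, hm₂⟩
  have h1 := one_lt_conjExponent hp hq
  refine ⟨fun s₁ s₂ => weightAvg p q m₁ m₂ c κ (v₁ s₁, v₂ s₂),
    fun _ _ _ _ => weightAvg_pos hp hq hc hκ.1 hnorm hm₂ _,
    fun x => (2 ^ (p - 1) + 4) * (‖x.1‖ ^ (p - 1) + ‖x.2‖ + ‖x.2‖ ^ (q - 1) + κ ^ (q - 1)),
    ?_, fun ζ η => ?_⟩
  · have c₁ : Continuous fun x : EuclProd m₁ m₂ => ‖x.1‖ ^ (p - 1) :=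
      continuous_fst.norm.rpow_const fun _ => Or.inr (by linarith)
    have c₂ : Continuous fun x : EuclProd m₁ m₂ => ‖x.2‖ ^ (q - 1) :=
      continuous_snd.norm.rpow_const fun _ => Or.inr (by linarith)
    exact (((c₁.add continuous_snd.norm).add c₂).add continuous_const).const_mul _
  have e : weightAvg p q m₁ m₂ c κ (v₁ ‖ζ‖, v₂ ‖η‖) = weightAvg p q m₁ m₂ c κ (ζ, η) :=
    weightAvg_congr (by simp [v₁]) (by simp [v₂])
  simp only [e]
  refine ⟨fun ω₁ ω₂ => le_fderiv_fderiv_regBellman hp hq hγ hc hκ.1 hnorm hm₂ (ζ, η) (ω₁, ω₂),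
    ?_, (abs_of_nonneg ?_).le⟩
  · have k₁ := sub_le_fderiv_regBellman hp hc hκ.1 (ζ, η)
    have k₂ := regBellman_zero_le (m₁ := m₁) (m₂ := m₂) hp hq hc hκ.1 hκ.2 hnorm
    have k₃ := sub_weightAvg_le_regBellman hp hq hγ hc hκ.1 hnorm hm₂ (ζ, η)
    have k₄ := mul_le_mul_of_nonneg_left (weightAvg_le hp hq hc hκ.1 hnorm (ζ, η))
      (mul_nonneg (bellmanGamma_pos hp hq hγ).le (sq_nonneg κ))
    have k₅ := error_le hp hq hγ hκ.1 hκ.2 (norm_nonneg ζ) (norm_nonneg η)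
    dsimp only at k₃ k₄
    linarith
  · have := hκ.1
    positivity
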